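/- Let A ⊂ ℝ² be an open bounded set and let E be a Cheeger set of A. Assume that: (1) the set bd_{∂A}(∂A ∩ ∂E) := (∂A ∩ ∂E) ∩ closure(∂A \ ∂E) is finite; and (2) every point of ∂A ∩ ∂E is a regular point of ∂A, i.e. ∂A ∩ ∂E ⊆ ∂*A. Then ℋ¹(∂E ∩ ∂A) > 0. -/

import Mathlib

open MeasureTheory Set Metric Filter Bornology
open scoped ENNReal NNReal Topology RealInnerProductSpace

noncomputable section

abbrev Euc (n : ℕ) := EuclideanSpace ℝ (Fin n)

/-- Divergence of a vector field on `ℝⁿ`. -/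
def vdiv {n : ℕ} (T : Euc n → Euc n) (x : Euc n) : ℝ :=
  ∑ i : Fin n, ⟪fderiv ℝ T x (EuclideanSpace.single i 1), EuclideanSpace.single i 1⟫

/-- The relative (distributional) perimeter of `E` inside `A`: the supremum of
`∫_E div T` over smooth, compactly supported vector fields `T` with `tsupport T ⊆ A`
and `‖T‖ ≤ 1`. -/
def perimeterIn {n : ℕ} (E A : Set (Euc n)) : ℝ≥0∞ :=
  ⨆ (T : Euc n → Euc n) (_ : ContDiff ℝ (⊤ : ℕ∞) T) (_ : HasCompactSupport T)
    (_ : tsupport T ⊆ A) (_ : ∀ x, ‖T x‖ ≤ 1),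
    ENNReal.ofReal (∫ x in E, vdiv T x)

/-- The (distributional) perimeter of `E`. -/
def perimeter {n : ℕ} (E : Set (Euc n)) : ℝ≥0∞ := perimeterIn E univ

/-- `E` has locally finite perimeter. -/
def HasLocFinitePerimeter {n : ℕ} (E : Set (Euc n)) : Prop :=
  ∀ (x : Euc n) (r : ℝ), perimeterIn E (ball x r) < ⊤

/-- `ν` is the measure-theoretic outer unit normal of `E` at `x`: blow-ups of `E`
at `x` converge in measure to the half space `{y : ⟪y - x, ν⟫ ≤ 0}`. -/
def blowsUpTo {n : ℕ} (E : Set (Euc n)) (x ν : Euc n) : Prop :=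
  ‖ν‖ = 1 ∧
    Tendsto (fun r : ℝ =>
        volume (symmDiff E {y : Euc n | ⟪y - x, ν⟫ ≤ 0} ∩ ball x r) / ENNReal.ofReal (r ^ n))
      (𝓝[>] (0 : ℝ)) (𝓝 0)

/-- The reduced boundary `∂* E`. -/
def redBoundary {n : ℕ} (E : Set (Euc n)) : Set (Euc n) :=
  {x | ∃ ν, blowsUpTo E x ν}

open Classical in
/-- The measure-theoretic outer unit normal `ν_E` (junk value `0` off `∂* E`). -/
def mtNormal {n : ℕ} (E : Set (Euc n)) (x : Euc n) : Euc n :=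
  if h : ∃ ν, blowsUpTo E x ν then h.choose else 0

/-- An `N`-cluster contained in `Ω`: `N` Borel subsets of `Ω`, with positive and finite
volume, finite perimeter, pairwise disjoint up to Lebesgue measure zero. -/
structure NCluster (n N : ℕ) (Ω : Set (Euc n)) where
  cham : Fin N → Set (Euc n)
  measurableSet_cham : ∀ i, MeasurableSet (cham i)
  cham_subset : ∀ i, cham i ⊆ Ω
  vol_pos : ∀ i, 0 < volume (cham i)
  vol_lt_top : ∀ i, volume (cham i) < ⊤
  perimeter_lt_top : ∀ i, perimeter (cham i) < ⊤
  ae_disjoint : ∀ i j, i ≠ j → volume (cham i ∩ cham j) = 0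

/-- The functional `Σᵢ P(𝓔(i))/|𝓔(i)|`. -/
def clusterEnergy {n N : ℕ} {Ω : Set (Euc n)} (𝓔 : NCluster n N Ω) : ℝ≥0∞ :=
  ∑ i, perimeter (𝓔.cham i) / volume (𝓔.cham i)

/-- The `N`-Cheeger constant `H_N(Ω)`. -/
def NCheeger (n N : ℕ) (Ω : Set (Euc n)) : ℝ≥0∞ :=
  ⨅ 𝓔 : NCluster n N Ω, clusterEnergy 𝓔

/-- A Cheeger `N`-cluster: a minimizer of `clusterEnergy`. -/
def IsCheegerNCluster {n N : ℕ} {Ω : Set (Euc n)} (𝓔 : NCluster n N Ω) : Prop :=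
  clusterEnergy 𝓔 = NCheeger n N Ω

/-- The Cheeger constant `h(A)`. -/
def cheegerConst {n : ℕ} (A : Set (Euc n)) : ℝ≥0∞ :=
  ⨅ (E : Set (Euc n)) (_ : MeasurableSet E) (_ : E ⊆ A) (_ : 0 < volume E),
    perimeter E / volume E

/-- A Cheeger set of `A`. -/
def IsCheegerSet {n : ℕ} (E A : Set (Euc n)) : Prop :=
  MeasurableSet E ∧ E ⊆ A ∧ 0 < volume E ∧ perimeter E / volume E = cheegerConst A

/-- `Ω` has `C¹` boundary: near each boundary point, `Ω` is the sublevel set of a `C¹`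
function with non-vanishing differential. -/
def HasC1Boundary {n : ℕ} (Ω : Set (Euc n)) : Prop :=
  ∀ x ∈ frontier Ω, ∃ (U : Set (Euc n)) (f : Euc n → ℝ), IsOpen U ∧ x ∈ U ∧
    ContDiff ℝ 1 f ∧ (∀ y ∈ U, fderiv ℝ f y ≠ 0) ∧ Ω ∩ U = {y ∈ U | f y < 0}

/-- The `n`-dimensional density of `E` at `x` exists and equals `d`. -/
def HasDensity {n : ℕ} (E : Set (Euc n)) (x : Euc n) (d : ℝ≥0∞) : Prop :=
  Tendsto (fun r : ℝ => volume (E ∩ ball x r) / volume (ball x r)) (𝓝[>] (0 : ℝ)) (𝓝 d)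

/-- The external chamber `𝓔(0) = Ω \ ⋃ᵢ 𝓔(i)`. -/
def extChamber {n N : ℕ} {Ω : Set (Euc n)} (𝓔 : NCluster n N Ω) : Set (Euc n) :=
  Ω \ ⋃ i, 𝓔.cham i

lemma inner_grad (f : Euc 2 → ℝ) (x v : Euc 2) : ⟪gradient f x, v⟫ = fderiv ℝ f x v := by
  rw [← toDual_gradient (𝕜 := ℝ)]
  simp

lemma norm_grad (f : Euc 2 → ℝ) (x : Euc 2) : ‖gradient f x‖ = ‖fderiv ℝ f x‖ := by
  rw [← toDual_gradient (𝕜 := ℝ)]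
  exact (LinearIsometryEquiv.norm_map _ _).symm

lemma cont_grad {f : Euc 2 → ℝ} (hf : ContDiff ℝ 1 f) : Continuous (gradient f) :=
  (InnerProductSpace.toDual ℝ (Euc 2)).symm.continuous.comp (hf.continuous_fderiv one_ne_zero)

lemma grad_zero_of_notMem {f : Euc 2 → ℝ} {x : Euc 2} (hx : x ∉ tsupport f) :
    gradient f x = 0 := by
  have : fderiv ℝ f x = 0 := by
    have := support_fderiv_subset ℝ (f := f)
    by_contra h
    exact hx (this h)
  rw [gradient, this, map_zero]

lemma compSupp_grad {f : Euc 2 → ℝ} (hf : HasCompactSupport f) : HasCompactSupport (gradient f) :=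
  hf.mono' (fun x hx => by
    by_contra h
    exact hx (grad_zero_of_notMem h))

lemma grad_mul {f g : Euc 2 → ℝ} {x : Euc 2} (hf : DifferentiableAt ℝ f x)
    (hg : DifferentiableAt ℝ g x) :
    gradient (fun y => f y * g y) x = f x • gradient g x + g x • gradient f x := by
  have : fderiv ℝ (fun y => f y * g y) x = f x • fderiv ℝ g x + g x • fderiv ℝ f x :=
    fderiv_fun_mul hf hg
  simp [gradient, this]

lemma grad_comp {f : Euc 2 → ℝ} {g : ℝ → ℝ} {x : Euc 2} (hf : DifferentiableAt ℝ f x)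
    (hg : DifferentiableAt ℝ g (f x)) :
    gradient (fun y => g (f y)) x = deriv g (f x) • gradient f x := by
  have : fderiv ℝ (fun y => g (f y)) x = deriv g (f x) • fderiv ℝ f x := by
    exact (hg.hasDerivAt.comp_hasFDerivAt x hf.hasFDerivAt).fderiv
  simp [gradient, this]

lemma integrable_cc {F : Type*} [NormedAddCommGroup F] {f : Euc 2 → F} (hf : Continuous f)
    (hc : HasCompactSupport f) : Integrable f :=
  hf.integrable_of_hasCompactSupport hc

lemma ibp_scalar {f g : Euc 2 → ℝ} (hf : ContDiff ℝ 1 f) (hg : ContDiff ℝ 1 g)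
    (hc : HasCompactSupport g) (v : Euc 2) :
    ∫ x, f x * fderiv ℝ g x v = - ∫ x, fderiv ℝ f x v * g x := by
  apply integral_mul_fderiv_eq_neg_fderiv_mul_of_integrable
  · exact integrable_cc (((hf.continuous_fderiv one_ne_zero).clm_apply continuous_const).mul
      hg.continuous) hc.mul_left
  · refine integrable_cc (hf.continuous.mul
      ((hg.continuous_fderiv one_ne_zero).clm_apply continuous_const)) ?_
    exact (HasCompactSupport.fderiv_apply ℝ hc v).mul_left
  · exact integrable_cc (hf.continuous.mul hg.continuous) hc.mul_left
  · exact fun x _ => hf.differentiable one_ne_zero x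
  · exact fun x _ => hg.differentiable one_ne_zero x

lemma ibp_vdiv {f : Euc 2 → ℝ} {T : Euc 2 → Euc 2} (hf : ContDiff ℝ 1 f) (hT : ContDiff ℝ 1 T)
    (hc : HasCompactSupport T) :
    ∫ x, f x * vdiv T x = - ∫ x, ⟪gradient f x, T x⟫ := by
  have hTi : ∀ i : Fin 2, ContDiff ℝ 1 (fun x => T x i) := fun i => by
    exact (contDiff_euclidean.1 hT) i
  have hci : ∀ i : Fin 2, HasCompactSupport (fun x => T x i) := fun i =>
    hc.comp_left (g := fun y : Euc 2 => y i) rfl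
  have hd : ∀ (i : Fin 2) x v, fderiv ℝ (fun x => T x i) x v = (fderiv ℝ T x v) i := by
    intro i x v
    have h1 := (hT.differentiable one_ne_zero x).hasFDerivAt
    have h2 := ((EuclideanSpace.proj i : Euc 2 →L[ℝ] ℝ).hasFDerivAt (x := T x)).comp x h1
    have h3 : fderiv ℝ (fun x => T x i) x = (EuclideanSpace.proj i : Euc 2 →L[ℝ] ℝ).comp (fderiv ℝ T x) := h2.fderiv
    rw [h3]; rfl
  have e1 : ∀ x, f x * vdiv T x = ∑ i : Fin 2, f x * fderiv ℝ (fun x => T x i) x (EuclideanSpace.single i 1) := by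
    intro x
    rw [vdiv, Finset.mul_sum]
    refine Finset.sum_congr rfl fun i _ => ?_
    rw [hd, EuclideanSpace.inner_single_right]
    simp
  have e2 : ∀ x, ⟪gradient f x, T x⟫ = ∑ i : Fin 2, fderiv ℝ f x (EuclideanSpace.single i 1) * T x i := by
    intro x
    rw [PiLp.inner_apply]
    refine Finset.sum_congr rfl fun i _ => ?_
    rw [← inner_grad, EuclideanSpace.inner_single_right]
    simp [mul_comm]
  simp_rw [e1, e2]
  rw [integral_finsetSum, integral_finsetSum, ← Finset.sum_neg_distrib]
  · exact Finset.sum_congr rfl fun i _ => ibp_scalar hf (hTi i) (hci i) _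
  · intro i _
    exact integrable_cc (((hf.continuous_fderiv one_ne_zero).clm_apply continuous_const).mul
      (hTi i).continuous) (hci i).mul_left
  · intro i _
    refine integrable_cc (hf.continuous.mul
      (((hTi i).continuous_fderiv one_ne_zero).clm_apply continuous_const)) ?_
    exact (HasCompactSupport.fderiv_apply ℝ (hci i) _).mul_left

lemma cont_vdiv {T : Euc 2 → Euc 2} (hT : ContDiff ℝ 1 T) : Continuous (vdiv T) := by
  unfold vdiv
  refine continuous_finsetSum _ fun i _ => ?_
  exact ((hT.continuous_fderiv one_ne_zero).clm_apply continuous_const).inner continuous_const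

lemma compSupp_vdiv {T : Euc 2 → Euc 2} (hc : HasCompactSupport T) :
    HasCompactSupport (vdiv T) := by
  refine (hc.fderiv ℝ).mono (fun x hx => ?_)
  intro h
  apply hx
  simp [vdiv, h]

/-- lower semicontinuity -/
lemma perimeter_le_liminf {F : Set (Euc 2)} (hF : MeasurableSet F) {f : ℕ → Euc 2 → ℝ}
    (hf : ∀ k, ContDiff ℝ 1 (f k)) (hb : ∀ k x, |f k x| ≤ 1)
    (hlim : ∀ x, Tendsto (fun k => f k x) atTop (𝓝 (F.indicator 1 x))) :
    perimeter F ≤ liminf (fun k => ∫⁻ x, ‖gradient (f k) x‖ₑ) atTop := by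
  unfold perimeter perimeterIn
  refine iSup_le fun T => iSup_le fun hT => iSup_le fun hc => iSup_le fun _ => iSup_le fun hn => ?_
  have hT1 : ContDiff ℝ 1 T := hT.of_le (by exact_mod_cast le_top)
  have h1 : Tendsto (fun k => ∫ x, f k x * vdiv T x) atTop (𝓝 (∫ x in F, vdiv T x)) := by
    rw [← integral_indicator hF]
    have : F.indicator (vdiv T) = fun x => F.indicator 1 x * vdiv T x := by
      ext x; by_cases hx : x ∈ F <;> simp [hx]
    rw [this]
    refine tendsto_integral_of_dominated_convergence (fun x => ‖vdiv T x‖) ?_ ?_ ?_ ?_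
    · exact fun k => ((hf k).continuous.mul (cont_vdiv hT1)).aestronglyMeasurable
    · exact (integrable_cc (cont_vdiv hT1) (compSupp_vdiv hc)).norm
    · refine fun k => ae_of_all _ fun x => ?_
      rw [norm_mul]
      exact mul_le_of_le_one_left (norm_nonneg _) (hb k x)
    · exact ae_of_all _ fun x => (hlim x).mul_const _
  have h2 := (ENNReal.continuous_ofReal.tendsto _).comp h1
  rw [← h2.liminf_eq]
  refine liminf_le_liminf (Eventually.of_forall fun k => ?_)
  simp only [Function.comp]
  rw [ibp_vdiv (hf k) hT1 hc, ← integral_neg]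
  refine (ENNReal.ofReal_le_ofReal (le_abs_self _)).trans ?_
  rw [← Real.norm_eq_abs, ofReal_norm]
  refine (enorm_integral_le_lintegral_enorm _).trans (lintegral_mono fun x => ?_)
  rw [enorm_neg, ← ofReal_norm, ← ofReal_norm]
  refine ENNReal.ofReal_le_ofReal ((norm_inner_le_norm _ _).trans ?_)
  exact mul_le_of_le_one_right (norm_nonneg _) (hn x)

lemma st_deriv_nonneg (x : ℝ) : 0 ≤ deriv Real.smoothTransition x :=
  Real.smoothTransition.monotone.deriv_nonneg

lemma st_contDiff : ContDiff ℝ 1 Real.smoothTransition := Real.smoothTransition.contDiff (n := 1)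

lemma st_deriv_cont : Continuous (deriv Real.smoothTransition) :=
  st_contDiff.continuous_deriv le_rfl

lemma st_deriv_zero {x : ℝ} (hx : x < 0 ∨ 1 < x) : deriv Real.smoothTransition x = 0 := by
  rcases hx with h | h
  · have : Real.smoothTransition =ᶠ[𝓝 x] fun _ => 0 := by
      filter_upwards [gt_mem_nhds h] with y hy
      exact Real.smoothTransition.zero_of_nonpos (le_of_lt hy)
    rw [this.deriv_eq]; simp
  · have : Real.smoothTransition =ᶠ[𝓝 x] fun _ => 1 := by
      filter_upwards [lt_mem_nhds h] with y hy
      exact Real.smoothTransition.one_of_one_le (le_of_lt hy)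
    rw [this.deriv_eq]; simp

lemma st_lintegral (k : ℝ) (hk : 0 < k) (c : ℝ) :
    ∫⁻ s : ℝ, ENNReal.ofReal (k * deriv Real.smoothTransition (k * (c - s))) ≤ 1 := by
  have hd : ∀ s, HasDerivAt (fun s => - Real.smoothTransition (k * (c - s)))
      (k * deriv Real.smoothTransition (k * (c - s))) s := by
    intro s
    have h1 := (st_contDiff.differentiable one_ne_zero (k * (c - s))).hasDerivAt
    have h2 : HasDerivAt (fun s => k * (c - s)) (k * (0 - 1)) s :=
      ((hasDerivAt_const s c).sub (hasDerivAt_id s)).const_mul k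
    have := (h1.comp s h2).neg
    exact this.congr_deriv (by ring)
  have hbot : Tendsto (fun s => - Real.smoothTransition (k * (c - s))) atBot (𝓝 (-1)) := by
    refine tendsto_const_nhds.congr' ?_
    filter_upwards [eventually_le_atBot (c - 1 / k)] with s hs
    rw [Real.smoothTransition.one_of_one_le]
    have : 1 / k ≤ c - s := by linarith
    calc 1 = k * (1 / k) := by field_simp
      _ ≤ _ := by gcongr
  have htop : Tendsto (fun s => - Real.smoothTransition (k * (c - s))) atTop (𝓝 0) := by
    refine tendsto_const_nhds.congr' ?_
    filter_upwards [eventually_ge_atTop c] with s hs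
    rw [Real.smoothTransition.zero_of_nonpos, neg_zero]
    exact mul_nonpos_of_nonneg_of_nonpos hk.le (by linarith)
  have hnn : ∀ s, 0 ≤ k * deriv Real.smoothTransition (k * (c - s)) :=
    fun s => mul_nonneg hk.le (st_deriv_nonneg _)
  have hIntg : Integrable (fun s => k * deriv Real.smoothTransition (k * (c - s))) :=
    Continuous.integrable_of_hasCompactSupport (by have := st_deriv_cont; fun_prop)
      (HasCompactSupport.intro (isCompact_Icc (a := c - 1 / k) (b := c)) fun s hs => by
        rw [st_deriv_zero, mul_zero]
        rcases not_and_or.1 hs with h | h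
        · right
          have : 1 / k < c - s := by linarith
          calc 1 = k * (1 / k) := by field_simp
            _ < _ := by gcongr
        · left
          exact mul_neg_of_pos_of_neg hk (by linarith))
  rw [← ofReal_integral_eq_lintegral_ofReal hIntg (ae_of_all _ hnn),
    integral_of_hasDerivAt_of_tendsto hd hIntg hbot htop]
  simp

/-- functional Cheeger inequality -/
lemma cheeger_fun_enn {A : Set (Euc 2)} {w : Euc 2 → ℝ} (hw : ContDiff ℝ 1 w)
    (hc : HasCompactSupport w) (hs : Function.support w ⊆ A) (h0 : ∀ x, 0 ≤ w x) :
    cheegerConst A * ∫⁻ x, ENNReal.ofReal (w x) ≤ ∫⁻ x, ‖gradient w x‖ₑ := by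
  let f : ℝ → ℕ → Euc 2 → ℝ := fun s k x => Real.smoothTransition ((k + 1 : ℝ) * (w x - s))
  have hgrad : ∀ s k x, gradient (f s k) x =
      ((k + 1 : ℝ) * deriv Real.smoothTransition ((k + 1 : ℝ) * (w x - s))) • gradient w x := by
    intro s k x
    have : HasDerivAt (fun y => Real.smoothTransition ((k + 1 : ℝ) * (y - s)))
      (deriv Real.smoothTransition ((k + 1 : ℝ) * (w x - s)) * ((k + 1 : ℝ) * 1)) (w x) := by
      have h1 := (st_contDiff.differentiable one_ne_zero ((k + 1 : ℝ) * (w x - s))).hasDerivAt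
      have h2 : HasDerivAt (fun y : ℝ => (k + 1 : ℝ) * (y - s)) ((k + 1 : ℝ) * 1) (w x) :=
        ((hasDerivAt_id (w x)).sub_const s).const_mul _
      exact h1.comp (w x) h2
    rw [grad_comp (g := fun y => Real.smoothTransition ((k + 1 : ℝ) * (y - s)))
      (hw.differentiable one_ne_zero x) this.differentiableAt, this.deriv]
    congr 1; ring
  have key : ∀ s ∈ Ioi (0 : ℝ), cheegerConst A * volume {x | s < w x} ≤
      liminf (fun k => ∫⁻ x, ‖gradient (f s k) x‖ₑ) atTop := by
    intro s hs0
    have hs0 : 0 < s := hs0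
    rcases eq_or_ne (volume {x | s < w x}) 0 with hv | hv
    · simp [hv]
    have hm : MeasurableSet {x | s < w x} := (isOpen_lt continuous_const hw.continuous).measurableSet
    have hsub : {x | s < w x} ⊆ Function.support w := fun x hx => by
      have : s < w x := hx
      simp only [Function.mem_support]; linarith
    have hfin : volume {x | s < w x} ≠ ⊤ :=
      ((measure_mono (hsub.trans (subset_tsupport w))).trans_lt hc.isCompact.measure_lt_top).ne
    have h1 : cheegerConst A ≤ perimeter {x | s < w x} / volume {x | s < w x} :=
      iInf_le_of_le _ (iInf_le_of_le hm (iInf_le_of_le (hsub.trans hs)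
        (iInf_le_of_le (pos_iff_ne_zero.2 hv) le_rfl)))
    rw [ENNReal.le_div_iff_mul_le (Or.inl hv) (Or.inl hfin)] at h1
    refine h1.trans (perimeter_le_liminf hm (fun k => ?_) (fun k x => ?_) (fun x => ?_))
    · exact st_contDiff.comp (contDiff_const.mul (hw.sub contDiff_const))
    · rw [abs_of_nonneg (Real.smoothTransition.nonneg _)]; exact Real.smoothTransition.le_one _
    · by_cases hx : s < w x
      · rw [indicator_of_mem (show x ∈ {x | s < w x} from hx)]
        refine tendsto_const_nhds.congr' ?_
        obtain ⟨n, hn⟩ := exists_nat_gt (1 / (w x - s))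
        filter_upwards [eventually_ge_atTop n] with k hk
        have hpos : 0 < w x - s := by linarith
        have : (1 : ℝ) ≤ (k + 1 : ℝ) * (w x - s) := by
          rw [div_lt_iff₀ hpos] at hn
          have : (n : ℝ) ≤ k := by exact_mod_cast hk
          nlinarith
        simp only [f]
        rw [Real.smoothTransition.one_of_one_le this]; rfl
      · rw [indicator_of_notMem (show x ∉ {x | s < w x} from hx)]
        refine tendsto_const_nhds.congr fun k => ?_
        simp only [f]
        rw [Real.smoothTransition.zero_of_nonpos]
        exact mul_nonpos_of_nonneg_of_nonpos (by positivity) (by linarith)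
  rw [lintegral_eq_lintegral_meas_lt volume (ae_of_all _ h0) hw.continuous.aemeasurable]
  have hgm : Measurable fun x => ‖gradient w x‖ₑ := (cont_grad hw).measurable.enorm
  have hjm : ∀ k : ℕ, Measurable (fun p : ℝ × Euc 2 =>
      ENNReal.ofReal ((k + 1 : ℝ) * deriv Real.smoothTransition ((k + 1 : ℝ) * (w p.2 - p.1)))) := by
    intro k
    refine ENNReal.measurable_ofReal.comp (Continuous.measurable ?_)
    have := hw.continuous
    have := st_deriv_cont
    fun_prop
  have hen : ∀ s k, ∫⁻ x, ‖gradient (f s k) x‖ₑ = ∫⁻ x, ENNReal.ofReal ((k + 1 : ℝ) *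
      deriv Real.smoothTransition ((k + 1 : ℝ) * (w x - s))) * ‖gradient w x‖ₑ := by
    intro s k
    refine lintegral_congr fun x => ?_
    rw [hgrad, enorm_smul, ← ofReal_norm, Real.norm_of_nonneg]
    exact mul_nonneg (by positivity) (st_deriv_nonneg _)
  have hmeas : ∀ k, Measurable fun s => ∫⁻ x, ‖gradient (f s k) x‖ₑ := by
    intro k
    simp_rw [hen]
    exact Measurable.lintegral_prod_right ((hjm k).mul (hgm.comp measurable_snd))
  have hmono : Measurable fun s : ℝ => volume {x | s < w x} :=
    Antitone.measurable fun s t hst => measure_mono fun x (hx : t < w x) => lt_of_le_of_lt hst hx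
  rw [← lintegral_const_mul _ hmono]
  calc ∫⁻ s in Ioi (0 : ℝ), cheegerConst A * volume {x | s < w x}
      ≤ ∫⁻ s in Ioi (0 : ℝ), liminf (fun k => ∫⁻ x, ‖gradient (f s k) x‖ₑ) atTop :=
        setLIntegral_mono' measurableSet_Ioi key
    _ ≤ ∫⁻ s, liminf (fun k => ∫⁻ x, ‖gradient (f s k) x‖ₑ) atTop := setLIntegral_le_lintegral _ _
    _ ≤ liminf (fun k => ∫⁻ s, ∫⁻ x, ‖gradient (f s k) x‖ₑ) atTop := lintegral_liminf_le hmeas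
    _ ≤ liminf (fun k : ℕ => ∫⁻ x, ‖gradient w x‖ₑ) atTop := by
        refine liminf_le_liminf (Eventually.of_forall fun k => ?_)
        simp_rw [hen]
        rw [lintegral_lintegral_swap ((hjm k).mul (hgm.comp measurable_snd)).aemeasurable]
        refine lintegral_mono fun x => ?_
        rw [lintegral_mul_const]
        · exact mul_le_of_le_one_left zero_le (st_lintegral _ (by positivity) _)
        · exact (hjm k).comp (measurable_id.prodMk measurable_const)
    _ = _ := by simp

/-- mollified characteristic function -/
def mollify (ρ : Euc 2 → ℝ) (E : Set (Euc 2)) (x : Euc 2) : ℝ :=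
  ∫ z, ρ z * E.indicator (fun _ => (1 : ℝ)) (x - z)

lemma mollify_fubini {ρ : Euc 2 → ℝ} {E : Set (Euc 2)} (hE : MeasurableSet E)
    (hρ : Continuous ρ) (hρc : HasCompactSupport ρ) {ψ : Euc 2 → ℝ} (hψ : Continuous ψ)
    (hψc : HasCompactSupport ψ) :
    ∫ x, mollify ρ E x * ψ x = ∫ z, ρ z * ∫ y in E, ψ (y + z) := by
  have hmI : Measurable (E.indicator (fun _ => (1 : ℝ))) := measurable_const.indicator hE
  have hIntg : Integrable (Function.uncurry fun (x z : Euc 2) =>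
      ρ z * E.indicator (fun _ => (1 : ℝ)) (x - z) * ψ x) (volume.prod volume) := by
    have h1 : Integrable (fun p : Euc 2 × Euc 2 => ψ p.1 * ρ p.2) (volume.prod volume) :=
      (integrable_cc hψ hψc).mul_prod (integrable_cc hρ hρc)
    refine h1.mono ?_ (ae_of_all _ fun p => ?_)
    · refine Measurable.aestronglyMeasurable ?_
      have a1 := hρ.measurable
      have a2 := hψ.measurable
      simp only [Function.uncurry_def]
      fun_prop
    · simp only [Function.uncurry, norm_mul]
      have : ‖E.indicator (fun _ => (1 : ℝ)) (p.1 - p.2)‖ ≤ 1 := by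
        by_cases h : p.1 - p.2 ∈ E <;> simp [h]
      calc ‖ρ p.2‖ * ‖E.indicator (fun _ => (1 : ℝ)) (p.1 - p.2)‖ * ‖ψ p.1‖
          ≤ ‖ρ p.2‖ * 1 * ‖ψ p.1‖ := by gcongr
        _ = _ := by ring
  calc ∫ x, mollify ρ E x * ψ x
      = ∫ x, ∫ z, ρ z * E.indicator (fun _ => (1 : ℝ)) (x - z) * ψ x := by
        refine integral_congr_ae (ae_of_all _ fun x => ?_)
        simp only [mollify]
        rw [integral_mul_const]
    _ = ∫ z, ∫ x, ρ z * E.indicator (fun _ => (1 : ℝ)) (x - z) * ψ x :=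
        integral_integral_swap hIntg
    _ = _ := by
        refine integral_congr_ae (ae_of_all _ fun z => ?_)
        simp only
        rw [← integral_add_right_eq_self _ z, ← integral_const_mul, ← integral_indicator hE]
        refine integral_congr_ae (ae_of_all _ fun y => ?_)
        by_cases h : y ∈ E <;> simp [h]

lemma vdiv_translate (T : Euc 2 → Euc 2) (z y : Euc 2) :
    vdiv (fun x => T (x + z)) y = vdiv T (y + z) := by
  unfold vdiv
  rw [fderiv_comp_add_right]

lemma integral_vdiv_le {E : Set (Euc 2)} (hP : perimeter E ≠ ⊤) {T : Euc 2 → Euc 2}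
    (hT : ContDiff ℝ (⊤ : ℕ∞) T) (hc : HasCompactSupport T) (hn : ∀ x, ‖T x‖ ≤ 1) :
    ∫ x in E, vdiv T x ≤ (perimeter E).toReal := by
  have : ENNReal.ofReal (∫ x in E, vdiv T x) ≤ perimeter E := by
    unfold perimeter perimeterIn
    exact le_iSup_of_le T (le_iSup_of_le hT (le_iSup_of_le hc
      (le_iSup_of_le (subset_univ _) (le_iSup_of_le hn le_rfl))))
  exact (ENNReal.ofReal_le_iff_le_toReal hP).1 this

lemma cs_translate {F : Type*} [NormedAddCommGroup F] {T : Euc 2 → F} (hc : HasCompactSupport T) (z : Euc 2) :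
    HasCompactSupport (fun x => T (x + z)) :=
  hc.comp_homeomorph (Homeomorph.addRight z)

lemma mollify_contDiff {ρ : Euc 2 → ℝ} {E : Set (Euc 2)} (hE : MeasurableSet E)
    (hρ : ContDiff ℝ (⊤ : ℕ∞) ρ) (hρc : HasCompactSupport ρ) :
    ContDiff ℝ (⊤ : ℕ∞) (mollify ρ E) := by
  have hli : LocallyIntegrable (E.indicator (fun _ => (1 : ℝ))) (volume : Measure (Euc 2)) :=
    (locallyIntegrable_const (1 : ℝ)).indicator hE
  exact hρc.contDiff_convolution_left (ContinuousLinearMap.mul ℝ ℝ) hρ hli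

lemma mollify_perimeter {ρ : Euc 2 → ℝ} {E : Set (Euc 2)} (hE : MeasurableSet E)
    (hP : perimeter E ≠ ⊤) (hρ : ContDiff ℝ (⊤ : ℕ∞) ρ) (hρc : HasCompactSupport ρ)
    (h0 : ∀ x, 0 ≤ ρ x) (h1 : ∫ x, ρ x = 1) (hc : HasCompactSupport (mollify ρ E)) :
    ∫ x, ‖gradient (mollify ρ E) x‖ ≤ (perimeter E).toReal := by
  set u := mollify ρ E with hu
  have hus : ContDiff ℝ (⊤ : ℕ∞) u := mollify_contDiff hE hρ hρc
  have hu1 : ContDiff ℝ 1 u := hus.of_le (by exact_mod_cast le_top)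
  have hg : ContDiff ℝ (⊤ : ℕ∞) (gradient u) := by
    have : ContDiff ℝ (⊤ : ℕ∞) (fderiv ℝ u) := hus.fderiv_right (by simp)
    exact (InnerProductSpace.toDual ℝ (Euc 2)).symm.contDiff.comp this
  have key : ∀ δ : ℝ, 0 < δ → ∫ x, ‖gradient u x‖ ≤
      (perimeter E).toReal + δ * volume.real (tsupport u) := by
    intro δ hδ
    let T : Euc 2 → Euc 2 := fun x => - ((Real.sqrt (‖gradient u x‖ ^ 2 + δ ^ 2))⁻¹ • gradient u x)
    have hpos : ∀ x, 0 < ‖gradient u x‖ ^ 2 + δ ^ 2 := fun x => by positivity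
    have hT : ContDiff ℝ (⊤ : ℕ∞) T := by
      have a1 : ContDiff ℝ (⊤ : ℕ∞) (fun x => Real.sqrt (‖gradient u x‖ ^ 2 + δ ^ 2)) :=
        (ContDiff.add (hg.norm_sq ℝ) contDiff_const).sqrt fun x => (hpos x).ne'
      have a2 : ContDiff ℝ (⊤ : ℕ∞) (fun x => (Real.sqrt (‖gradient u x‖ ^ 2 + δ ^ 2))⁻¹) :=
        a1.inv fun x => (Real.sqrt_pos.2 (hpos x)).ne'
      exact (a2.smul hg).neg
    have hTc : HasCompactSupport T := by
      refine (compSupp_grad hc).mono fun x hx => ?_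
      intro h
      apply hx
      simp [T, h]
    have hTn : ∀ x, ‖T x‖ ≤ 1 := by
      intro x
      simp only [T, norm_neg, norm_smul, norm_inv, Real.norm_eq_abs, abs_of_nonneg (Real.sqrt_nonneg _)]
      rw [inv_mul_le_iff₀ (Real.sqrt_pos.2 (hpos x)), mul_one]
      apply Real.le_sqrt_of_sq_le
      nlinarith [sq_nonneg δ]
    have hT1 : ContDiff ℝ 1 T := hT.of_le (by exact_mod_cast le_top)
    have e1 : ∫ x, u x * vdiv T x ≤ (perimeter E).toReal := by
      rw [hu, mollify_fubini hE hρ.continuous hρc (cont_vdiv hT1) (compSupp_vdiv hTc)]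
      calc ∫ z, ρ z * ∫ y in E, vdiv T (y + z)
          ≤ ∫ z, ρ z * (perimeter E).toReal := by
            have hle : ∀ z, ρ z * ∫ y in E, vdiv T (y + z) ≤ ρ z * (perimeter E).toReal := by
              intro z
              refine mul_le_mul_of_nonneg_left ?_ (h0 z)
              have := integral_vdiv_le (T := fun x => T (x + z)) hP
                (hT.comp (contDiff_id.add contDiff_const)) (cs_translate hTc z) (fun x => hTn _)
              simpa only [vdiv_translate] using this
            by_cases hi : Integrable (fun z => ρ z * ∫ y in E, vdiv T (y + z))
            · exact integral_mono hi ((integrable_cc hρ.continuous hρc).mul_const _) hle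
            · rw [integral_undef hi]
              exact integral_nonneg fun z => mul_nonneg (h0 z) ENNReal.toReal_nonneg
        _ = _ := by rw [integral_mul_const, h1, one_mul]
    rw [ibp_vdiv hu1 hT1 hTc, ← integral_neg] at e1
    have hind : Integrable ((tsupport u).indicator (fun _ => δ)) :=
      (integrable_indicator_iff (isClosed_tsupport u).measurableSet).2
        (integrableOn_const (hc.isCompact.measure_lt_top.ne))
    have e2 : ∫ x, (‖gradient u x‖ - (tsupport u).indicator (fun _ => δ) x) ≤
        ∫ x, -⟪gradient u x, T x⟫ := by
      refine integral_mono ?_ ?_ fun x => ?_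
      · refine (integrable_cc (cont_grad hu1).norm (compSupp_grad hc).norm).sub ?_
        exact hind
      · refine (integrable_cc ((cont_grad hu1).inner hT1.continuous) ?_).neg
        refine (compSupp_grad hc).mono fun x hx => ?_
        intro h
        apply hx
        simp [h]
      · simp only
        by_cases hx : x ∈ tsupport u
        · simp only [hx, indicator_of_mem, T, inner_neg_right, neg_neg, inner_smul_right,
            real_inner_self_eq_norm_sq]
          set m := ‖gradient u x‖
          have hm : 0 ≤ m := norm_nonneg _
          have hs : Real.sqrt (m ^ 2 + δ ^ 2) ≤ m + δ := by
            rw [Real.sqrt_le_left (by positivity)]; nlinarith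
          have hs0 : 0 < Real.sqrt (m ^ 2 + δ ^ 2) := Real.sqrt_pos.2 (hpos x)
          rw [inv_mul_eq_div, le_div_iff₀ hs0]
          rcases le_total m δ with h | h
          · nlinarith
          · nlinarith
        · simp [hx, grad_zero_of_notMem hx]
    rw [integral_sub (integrable_cc (cont_grad hu1).norm (compSupp_grad hc).norm) hind,
      integral_indicator (isClosed_tsupport u).measurableSet] at e2
    simp only [setIntegral_const, smul_eq_mul] at e2
    linarith
  refine le_of_forall_pos_le_add fun ε hε => ?_
  have := key (ε / (volume.real (tsupport u) + 1)) (by positivity)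
  have h3 : ε / (volume.real (tsupport u) + 1) * volume.real (tsupport u) ≤ ε := by
    rw [div_mul_eq_mul_div, div_le_iff₀ (by positivity)]
    nlinarith [measureReal_nonneg (μ := volume) (s := tsupport u)]
  linarith


structure MolSeq (E : Set (Euc 2)) (u : ℕ → Euc 2 → ℝ) : Prop where
  smooth : ∀ k, ContDiff ℝ (⊤ : ℕ∞) (u k)
  nonneg : ∀ k x, 0 ≤ u k x
  le_one : ∀ k x, u k x ≤ 1
  supp : ∀ k, Function.support (u k) ⊆ cthickening (1 / ((k : ℝ) + 1)) E
  compSupp : ∀ k, HasCompactSupport (u k)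
  grad_le : ∀ k, ∫ x, ‖gradient (u k) x‖ ≤ (perimeter E).toReal
  lim : ∀ ψ : Euc 2 → ℝ, Continuous ψ →
    Tendsto (fun k => ∫ x, u k x * ψ x) atTop (𝓝 (∫ x in E, ψ x))

lemma cont_translate_integral {E : Set (Euc 2)} (hE : MeasurableSet E) (hEb : IsBounded E)
    {ψ : Euc 2 → ℝ} (hψ : Continuous ψ) (hψc : HasCompactSupport ψ) :
    Continuous (fun z => ∫ y in E, ψ (y + z)) := by
  obtain ⟨C, hC⟩ := hψ.bounded_above_of_compact_support hψc
  refine continuous_of_dominated (bound := fun _ => C) ?_ ?_ ?_ ?_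
  · intro z
    exact (hψ.comp (continuous_id.add continuous_const)).aestronglyMeasurable
  · intro z
    exact ae_of_all _ fun y => hC _
  · exact integrableOn_const hEb.measure_lt_top.ne
  · exact ae_of_all _ fun y => hψ.comp (continuous_const.add continuous_id)

lemma exists_mollifiers {E : Set (Euc 2)} (hE : MeasurableSet E) (hEb : IsBounded E)
    (hP : perimeter E ≠ ⊤) : ∃ u : ℕ → Euc 2 → ℝ, MolSeq E u := by
  let φ : ℕ → ContDiffBump (0 : Euc 2) := fun k =>
    ⟨1 / (2 * ((k : ℝ) + 1)), 1 / ((k : ℝ) + 1), by positivity, by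
      apply one_div_lt_one_div_of_lt <;> linarith [(Nat.cast_nonneg k : (0 : ℝ) ≤ k)]⟩
  let ρ : ℕ → Euc 2 → ℝ := fun k => (φ k).normed volume
  let u : ℕ → Euc 2 → ℝ := fun k => mollify (ρ k) E
  have hρ : ∀ k, ContDiff ℝ (⊤ : ℕ∞) (ρ k) := fun k => (φ k).contDiff_normed
  have hρc : ∀ k, HasCompactSupport (ρ k) := fun k => (φ k).hasCompactSupport_normed
  have hρ0 : ∀ k x, 0 ≤ ρ k x := fun k x => (φ k).nonneg_normed x
  have hρ1 : ∀ k, ∫ x, ρ k x = 1 := fun k => (φ k).integral_normed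
  have hρs : ∀ (k : ℕ) (x : Euc 2), 1 / ((k : ℝ) + 1) ≤ ‖x‖ → ρ k x = 0 := by
    intro k x hx
    have := (φ k).support_normed_eq (μ := volume)
    by_contra h
    have h2 : x ∈ Function.support ((φ k).normed volume) := h
    rw [this] at h2
    simp only [mem_ball, dist_zero_right] at h2
    exact absurd h2 (not_lt.2 hx)
  have hsupp : ∀ k, Function.support (u k) ⊆ cthickening (1 / ((k : ℝ) + 1)) E := by
    intro k x hx
    by_contra h
    apply hx
    simp only [u, mollify]
    refine integral_eq_zero_of_ae (ae_of_all _ fun z => ?_)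
    simp only [Pi.zero_apply, mul_eq_zero]
    by_cases hz : x - z ∈ E
    · left
      apply hρs
      by_contra h3
      apply h
      apply mem_cthickening_of_dist_le x (x - z) _ _ hz
      rw [dist_eq_norm]
      simpa using (not_le.1 h3).le
    · right; simp [hz]
  have hcs : ∀ k, HasCompactSupport (u k) := fun k =>
    HasCompactSupport.intro (K := cthickening (1 / ((k : ℝ) + 1)) E)
      (Metric.isCompact_of_isClosed_isBounded isClosed_cthickening hEb.cthickening)
      (fun x hx => by
        by_contra h
        exact hx (hsupp k h))
  have hlim0 : ∀ ψ : Euc 2 → ℝ, Continuous ψ → HasCompactSupport ψ →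
      Tendsto (fun k => ∫ x, u k x * ψ x) atTop (𝓝 (∫ x in E, ψ x)) := by
    intro ψ hψ hψc
    have hΨ := (cont_translate_integral hE hEb hψ hψc).comp continuous_neg
    have := ContDiffBump.convolution_tendsto_right_of_continuous (φ := φ) (μ := volume)
      (l := atTop) (tendsto_one_div_add_atTop_nhds_zero_nat) hΨ 0
    simp only [Function.comp, neg_zero, add_zero] at this
    refine this.congr fun k => ?_
    rw [mollify_fubini hE (hρ k).continuous (hρc k) hψ hψc]
    simp only [convolution, ContinuousLinearMap.lsmul_apply, smul_eq_mul]
    refine integral_congr_ae (ae_of_all _ fun z => ?_)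
    simp [ρ]
  refine ⟨u, ?_, ?_, ?_, hsupp, hcs, ?_, ?_⟩
  · exact fun k => mollify_contDiff hE (hρ k) (hρc k)
  · intro k x
    refine integral_nonneg fun z => mul_nonneg (hρ0 k z) ?_
    exact indicator_nonneg (fun _ _ => zero_le_one) _
  · intro k x
    rw [← hρ1 k]
    refine integral_mono_of_nonneg (ae_of_all _ fun z => mul_nonneg (hρ0 k z) ?_)
      (integrable_cc (hρ k).continuous (hρc k)) (ae_of_all _ fun z => ?_)
    · exact indicator_nonneg (fun _ _ => zero_le_one) _
    · have : E.indicator (fun _ => (1 : ℝ)) (x - z) ≤ 1 := by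
        by_cases h : x - z ∈ E <;> simp [h]
      calc ρ k z * E.indicator (fun _ => (1 : ℝ)) (x - z) ≤ ρ k z * 1 :=
            mul_le_mul_of_nonneg_left this (hρ0 k z)
        _ = _ := mul_one _
  · exact fun k => mollify_perimeter hE hP (hρ k) (hρc k) (hρ0 k) (hρ1 k) (hcs k)
  · intro ψ hψ
    obtain ⟨R, hR0, hR⟩ := hEb.cthickening (δ := 1) |>.subset_ball_lt 0 (0 : Euc 2)
    let χ : ContDiffBump (0 : Euc 2) := ⟨R, R + 1, hR0, by linarith⟩
    have h1 := hlim0 (fun x => χ x * ψ x) (χ.continuous.mul hψ) (χ.hasCompactSupport.mul_right)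
    have hχ : ∀ x ∈ cthickening 1 E, χ x = 1 := fun x hx =>
      χ.one_of_mem_closedBall (ball_subset_closedBall (hR hx))
    have e1 : ∫ x in E, χ x * ψ x = ∫ x in E, ψ x := by
      refine setIntegral_congr_fun hE fun x hx => ?_
      show χ x * ψ x = ψ x
      rw [hχ x (self_subset_cthickening E hx), one_mul]
    rw [e1] at h1
    refine h1.congr fun k => ?_
    refine integral_congr_ae (ae_of_all _ fun x => ?_)
    simp only
    by_cases hx : u k x = 0
    · simp [hx]
    · have : x ∈ cthickening 1 E := by
        refine cthickening_mono ?_ E (hsupp k hx)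
        rw [div_le_one (by positivity)]
        linarith [(Nat.cast_nonneg k : (0 : ℝ) ≤ k)]
      rw [hχ x this, one_mul]

lemma vol_pos_out {A : Set (Euc 2)} {x : Euc 2} (hx : x ∈ redBoundary A) {r₀ : ℝ} (hr₀ : 0 < r₀) :
    0 < volume (ball x r₀ \ A) := by
  obtain ⟨ν, hν, hlim⟩ := hx
  by_contra h0
  have h0 : volume (ball x r₀ \ A) = 0 := by simpa using h0
  have hc : (0 : ℝ≥0∞) < volume (ball (0 : Euc 2) 1) / 4 :=
    ENNReal.div_pos (measure_ball_pos _ _ one_pos).ne' (by norm_num)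
  have hev := hlim.eventually (gt_mem_nhds hc)
  have hev2 : ∀ᶠ r : ℝ in 𝓝[>] 0, r < r₀ ∧ 0 < r := by
    filter_upwards [Ioo_mem_nhdsGT hr₀] with r hr using ⟨hr.2, hr.1⟩
  obtain ⟨r, h1, hr0, hr⟩ := (hev.and hev2).exists
  let B := ball (x + (r / 2) • ν) (r / 2)
  have hB1 : B ⊆ ball x r := by
    refine ball_subset_ball' ?_
    rw [dist_eq_norm]
    simp [norm_smul, hν, abs_of_pos hr]
  have hB2 : ∀ y ∈ B, 0 < ⟪y - x, ν⟫ := by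
    intro y hy
    have h3 : ‖y - (x + (r / 2) • ν)‖ < r / 2 := by simpa [B, dist_eq_norm] using hy
    have h4 : |⟪y - (x + (r / 2) • ν), ν⟫| ≤ ‖y - (x + (r / 2) • ν)‖ := by
      have := abs_real_inner_le_norm (y - (x + (r / 2) • ν)) ν
      rwa [hν, mul_one] at this
    have h5 : ⟪y - x, ν⟫ = ⟪y - (x + (r / 2) • ν), ν⟫ + r / 2 := by
      simp only [inner_sub_left, inner_add_left, inner_smul_left, real_inner_self_eq_norm_sq, hν]
      simp
      ring
    have := abs_le.1 h4
    linarith [this.1]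
  have hB3 : volume B ≤ volume (symmDiff A {y : Euc 2 | ⟪y - x, ν⟫ ≤ 0} ∩ ball x r) := by
    calc volume B ≤ volume (B ∩ A) + volume (B \ A) := measure_le_inter_add_sdiff _ _ _
      _ ≤ volume (B ∩ A) + volume (ball x r₀ \ A) := by
          gcongr
          exact hB1.trans (ball_subset_ball hr0.le)
      _ = volume (B ∩ A) := by rw [h0, add_zero]
      _ ≤ _ := by
          apply measure_mono
          intro y hy
          refine ⟨Or.inl ⟨hy.2, ?_⟩, hB1 hy.1⟩
          simpa using hB2 y hy.1
  have hB4 : volume B = ENNReal.ofReal (r ^ 2) * (volume (ball (0 : Euc 2) 1) / 4) := by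
    simp only [B]
    rw [Measure.addHaar_ball_of_pos _ _ (by positivity)]
    simp only [finrank_euclideanSpace, Fintype.card_fin]
    rw [div_pow, ENNReal.ofReal_div_of_pos (by norm_num)]
    norm_num
    rw [ENNReal.div_eq_inv_mul, ENNReal.div_eq_inv_mul]
    ring
  have hpos : ENNReal.ofReal (r ^ 2) ≠ 0 := by
    simp only [ne_eq, ENNReal.ofReal_eq_zero, not_le]; positivity
  have := (ENNReal.div_lt_iff (Or.inl hpos) (Or.inl ENNReal.ofReal_ne_top)).1 h1
  rw [mul_comm] at this
  exact absurd (this.trans_le' hB3) (by rw [hB4]; exact lt_irrefl _)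

/-- in the plane every vector has a unit orthogonal vector -/
lemma exists_orth (e : Euc 2) : ∃ n : Euc 2, ‖n‖ = 1 ∧ ⟪e, n⟫ = 0 := by
  by_cases he : e = 0
  · exact ⟨EuclideanSpace.single 0 1, by simp, by simp [he]⟩
  · have hn : ‖e‖ ≠ 0 := norm_ne_zero_iff.2 he
    let m : Euc 2 := !₂[-e 1, e 0]
    have hm : ‖m‖ = ‖e‖ := by
      simp [m, EuclideanSpace.norm_eq, Fin.sum_univ_two, add_comm]
    refine ⟨‖e‖⁻¹ • m, ?_, ?_⟩
    · rw [norm_smul, hm, norm_inv, norm_norm, inv_mul_cancel₀ hn]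
    · rw [inner_smul_right]
      simp [m, PiLp.inner_apply, Fin.sum_univ_two]
      right; ring

lemma hausdorff_sep {A U : Set (Euc 2)} (hA : IsOpen A) (hU : IsOpen U) (hUc : Convex ℝ U)
    {a b : Euc 2} (ha : a ∈ A) (haU : a ∈ U) (hb : b ∉ closure A) (hbU : b ∈ U) :
    0 < μH[(1 : ℝ)] (U ∩ frontier A) := by
  obtain ⟨ε₁, hε₁, h1⟩ := Metric.isOpen_iff.1 (hA.inter hU) a ⟨ha, haU⟩
  obtain ⟨ε₂, hε₂, h2⟩ := Metric.isOpen_iff.1 (isClosed_closure.isOpen_compl.inter hU) b ⟨hb, hbU⟩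
  obtain ⟨n, hn, hen⟩ := exists_orth (b - a)
  let f : Euc 2 → ℝ := fun y => ⟪y - a, n⟫
  have hf : LipschitzWith 1 f := by
    refine LipschitzWith.of_dist_le_mul fun x y => ?_
    have : f x - f y = ⟪x - y, n⟫ := by simp [f, inner_sub_left]
    rw [Real.dist_eq, this, dist_eq_norm]
    have := abs_real_inner_le_norm (x - y) n
    rw [hn, mul_one] at this
    simpa using this
  let ε := min ε₁ ε₂
  have hε : 0 < ε := lt_min hε₁ hε₂
  have himg : Ioo (0 : ℝ) ε ⊆ f '' (U ∩ frontier A) := by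
    intro s hs
    have e0 : ‖s • n‖ < ε := by
      rw [norm_smul, hn, mul_one, Real.norm_eq_abs, abs_of_pos hs.1]; exact hs.2
    have ha' : a + s • n ∈ A ∩ U := h1 (by
      rw [mem_ball, dist_eq_norm]; simpa using e0.trans_le (min_le_left _ _))
    have hb' : b + s • n ∈ (closure A)ᶜ ∩ U := h2 (by
      rw [mem_ball, dist_eq_norm]; simpa using e0.trans_le (min_le_right _ _))
    have hseg := (convex_segment (𝕜 := ℝ) (a + s • n) (b + s • n)).isPreconnected
    obtain ⟨y, hy, hyA⟩ : ∃ y ∈ segment ℝ (a + s • n) (b + s • n), y ∈ frontier A := by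
      by_contra hno
      push Not at hno
      obtain ⟨y, -, hy1, hy2⟩ := hseg A (closure A)ᶜ hA isClosed_closure.isOpen_compl
        (fun y hy => by
          by_contra h
          simp only [mem_union, mem_compl_iff, not_or, not_not] at h
          apply hno y hy
          rw [hA.frontier_eq]
          exact ⟨h.2, h.1⟩)
        ⟨_, left_mem_segment _ _ _, ha'.1⟩ ⟨_, right_mem_segment _ _ _, hb'.1⟩
      exact hy2 (subset_closure hy1)
    refine ⟨y, ⟨hUc.segment_subset ha'.2 hb'.2 hy, hyA⟩, ?_⟩
    rw [segment_eq_image'] at hy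
    obtain ⟨t, -, rfl⟩ := hy
    have : a + s • n + t • (b + s • n - (a + s • n)) - a = s • n + t • (b - a) := by
      module
    simp only [f]
    rw [this, inner_add_left, inner_smul_left, inner_smul_left, hen, real_inner_self_eq_norm_sq, hn]
    simp
  have h3 : μH[(1 : ℝ)] (f '' (U ∩ frontier A)) ≤ μH[(1 : ℝ)] (U ∩ frontier A) := by
    have := hf.hausdorffMeasure_image_le (d := 1) zero_le_one (U ∩ frontier A)
    simpa using this
  refine lt_of_lt_of_le ?_ h3
  rw [hausdorffMeasure_real]
  refine lt_of_lt_of_le ?_ (measure_mono himg)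
  rw [Real.volume_Ioo]
  simpa using hε

lemma vol_zero_of_hausdorff {S : Set (Euc 2)} (h : μH[(1 : ℝ)] S = 0) : volume S = 0 := by
  have h2 : μH[(2 : ℝ)] S = 0 :=
    le_antisymm ((Measure.hausdorffMeasure_mono (by norm_num) S).trans h.le) bot_le
  have hh : μH[((Module.finrank ℝ (Euc 2) : ℕ) : ℝ)] S = 0 := by simpa using h2
  exact (Measure.absolutelyContinuous_isAddHaarMeasure volume
    (μH[((Module.finrank ℝ (Euc 2) : ℕ) : ℝ)])) hh

lemma mem_closure_of_null {A E : Set (Euc 2)} (hA : IsOpen A)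
    (h0 : μH[(1 : ℝ)] (frontier E ∩ frontier A) = 0) {x : Euc 2}
    (hx : x ∈ frontier A ∩ frontier E) (hr : x ∈ redBoundary A) :
    x ∈ closure (frontier A \ frontier E) := by
  by_contra hc
  obtain ⟨r, hr0, hrU⟩ := Metric.isOpen_iff.1 (isClosed_closure.isOpen_compl) x hc
  have hnull : μH[(1 : ℝ)] (ball x r ∩ frontier A) = 0 := by
    refine measure_mono_null ?_ h0
    intro y hy
    refine ⟨?_, hy.2⟩
    by_contra hyE
    exact hrU hy.1 (subset_closure ⟨hy.2, hyE⟩)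
  have hv : volume ((ball x r \ A) \ (ball x r ∩ frontier A)) ≠ 0 := by
    rw [measure_sdiff_null (vol_zero_of_hausdorff hnull)]
    exact (vol_pos_out hr hr0).ne'
  obtain ⟨b, ⟨hb1, hb2⟩, hb3⟩ := nonempty_of_measure_ne_zero hv
  obtain ⟨a, ha, haU⟩ := Metric.mem_closure_iff.1 (frontier_subset_closure hx.1) r hr0
  have := hausdorff_sep hA isOpen_ball (convex_ball x r) ha
    (by rw [mem_ball, dist_comm]; exact haU) (b := b) (fun h => by
      rw [closure_eq_self_union_frontier] at h
      rcases h with h | h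
      · exact hb2 h
      · exact hb3 ⟨hb1, h⟩) hb1
  exact this.ne' hnull

structure Ctx (A E : Set (Euc 2)) (K : Finset (Euc 2)) (u : ℕ → Euc 2 → ℝ) (h : ℝ) : Prop where
  openA : IsOpen A
  bddA : IsBounded A
  measE : MeasurableSet E
  sub : E ⊆ A
  volpos : 0 < volume.real E
  hpos : 0 < h
  perim : (perimeter E).toReal = h * volume.real E
  mol : MolSeq E u
  clos : closure E ⊆ A ∪ K
  fun_ineq : ∀ w : Euc 2 → ℝ, ContDiff ℝ 1 w → HasCompactSupport w → Function.support w ⊆ A →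
    (∀ x, 0 ≤ w x) → h * ∫ x, w x ≤ ∫ x, ‖gradient w x‖
  normal : ∀ q ∈ K, ∃ ν, blowsUpTo A q ν

lemma cheeger_ne_top {A : Set (Euc 2)} (hA : IsOpen A) (hne : A.Nonempty) :
    cheegerConst A ≠ ⊤ := by
  obtain ⟨a, ha⟩ := hne
  obtain ⟨r, hr, hrA⟩ := Metric.isOpen_iff.1 hA a ha
  let w : ContDiffBump a := ⟨r / 2, r, by positivity, by linarith⟩
  have hw : ContDiff ℝ 1 w := w.contDiff
  have h1 := cheeger_fun_enn (A := A) (w := w) hw w.hasCompactSupport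
    (by rw [w.support_eq]; exact hrA) (fun x => w.nonneg)
  have h2 : ∫⁻ x, ‖gradient w x‖ₑ < ⊤ :=
    (integrable_cc (cont_grad hw) (compSupp_grad w.hasCompactSupport)).2
  have h3 : ∫⁻ x, ENNReal.ofReal (w x) ≠ 0 := by
    rw [← ofReal_integral_eq_lintegral_ofReal w.integrable (ae_of_all _ fun x => w.nonneg)]
    simpa using w.integral_pos
  intro htop
  rw [htop, ENNReal.top_mul h3] at h1
  exact absurd h2 (not_lt.2 h1)

lemma fun_ineq_real {A : Set (Euc 2)} (hc : cheegerConst A ≠ ⊤) {w : Euc 2 → ℝ}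
    (hw : ContDiff ℝ 1 w)
    (hcs : HasCompactSupport w) (hs : Function.support w ⊆ A) (h0 : ∀ x, 0 ≤ w x) :
    (cheegerConst A).toReal * ∫ x, w x ≤ ∫ x, ‖gradient w x‖ := by
  have h1 := cheeger_fun_enn hw hcs hs h0
  have i1 := integrable_cc hw.continuous hcs
  have i2 := integrable_cc (cont_grad hw) (compSupp_grad hcs)
  rw [← ofReal_integral_eq_lintegral_ofReal i1 (ae_of_all _ h0), ← ofReal_integral_norm_eq_lintegral_enorm i2,
    ← ENNReal.ofReal_toReal hc, ← ENNReal.ofReal_mul ENNReal.toReal_nonneg] at h1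
  exact (ENNReal.ofReal_le_ofReal_iff (integral_nonneg fun x => norm_nonneg _)).1 h1

lemma perimeter_pos {E : Set (Euc 2)} (hE : MeasurableSet E) (hb : IsBounded E)
    (hP : perimeter E ≠ ⊤) (hv : 0 < volume.real E) : 0 < (perimeter E).toReal := by
  obtain ⟨R, hR0, hR⟩ := hb.subset_ball_lt 0 (0 : Euc 2)
  let χ : ContDiffBump (0 : Euc 2) := ⟨R, R + 1, hR0, by linarith⟩
  let T : Euc 2 → Euc 2 := fun x => (χ x * (R + 1)⁻¹) • x
  have hT : ContDiff ℝ (⊤ : ℕ∞) T := (χ.contDiff.mul contDiff_const).smul contDiff_id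
  have hTc : HasCompactSupport T := by
    refine χ.hasCompactSupport.mono fun x hx h => hx ?_
    simp [T, h]
  have hn : ∀ x, ‖T x‖ ≤ 1 := by
    intro x
    by_cases hx : x ∈ ball (0 : Euc 2) (R + 1)
    · rw [mem_ball_zero_iff] at hx
      simp only [T, norm_smul, norm_mul, Real.norm_eq_abs, abs_of_nonneg (χ.nonneg (x := x)),
        abs_of_pos (inv_pos.2 (by linarith : (0 : ℝ) < R + 1))]
      calc χ x * (R + 1)⁻¹ * ‖x‖ ≤ 1 * (R + 1)⁻¹ * (R + 1) := by
            gcongr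
            exact χ.le_one
        _ = 1 := by field_simp
    · have : χ x = 0 := by
        have h2 := χ.support_eq
        by_contra h3
        have h4 : x ∈ Function.support χ := h3
        rw [h2] at h4
        exact hx h4
      simp [T, this]
  have h1 := integral_vdiv_le hP hT hTc hn
  have h2 : ∫ x in E, vdiv T x = ∫ x in E, 2 * (R + 1)⁻¹ := by
    refine setIntegral_congr_fun hE fun x hx => ?_
    have hev : T =ᶠ[𝓝 x] fun y => (R + 1)⁻¹ • y := by
      filter_upwards [isOpen_ball.mem_nhds (hR hx)] with y hy
      simp only [T]
      rw [χ.one_of_mem_closedBall (ball_subset_closedBall hy), one_mul]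
    have hd : fderiv ℝ T x = (R + 1)⁻¹ • ContinuousLinearMap.id ℝ (Euc 2) := by
      rw [hev.fderiv_eq]
      exact ((hasFDerivAt_id x).const_smul (R + 1)⁻¹).fderiv
    simp only [vdiv, hd]
    simp [inner_smul_left]
  rw [h2] at h1
  simp only [setIntegral_const, smul_eq_mul] at h1
  exact lt_of_lt_of_le (by positivity) h1

lemma exists_ctx (A E : Set (Euc 2))
    (hAopen : IsOpen A) (hAbd : IsBounded A) (hE : IsCheegerSet E A)
    (hfin : Set.Finite ((frontier A ∩ frontier E) ∩ closure (frontier A \ frontier E)))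
    (hreg : frontier A ∩ frontier E ⊆ redBoundary A)
    (h0 : μH[(1 : ℝ)] (frontier E ∩ frontier A) = 0) :
    ∃ K u h, Ctx A E K u h := by
  obtain ⟨hm, hs, hv, hc⟩ := hE
  have hEb : IsBounded E := hAbd.subset hs
  have hvt : volume E ≠ ⊤ := hEb.measure_lt_top.ne
  have hne : E.Nonempty := nonempty_of_measure_ne_zero hv.ne'
  have hct := cheeger_ne_top hAopen (hne.mono hs)
  have hPeq : perimeter E = cheegerConst A * volume E := by
    rw [← hc, ENNReal.div_mul_cancel hv.ne' hvt]
  have hP : perimeter E ≠ ⊤ := by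
    rw [hPeq]; exact ENNReal.mul_ne_top hct hvt
  have hvr : 0 < volume.real E := ENNReal.toReal_pos hv.ne' hvt
  have hPr : (perimeter E).toReal = (cheegerConst A).toReal * volume.real E := by
    rw [hPeq, ENNReal.toReal_mul]; rfl
  obtain ⟨u, hu⟩ := exists_mollifiers hm hEb hP
  have hPp := perimeter_pos hm hEb hP hvr
  refine ⟨hfin.toFinset, u, (cheegerConst A).toReal, hAopen, hAbd, hm, hs, hvr, ?_, hPr, hu, ?_,
    fun w h1 h2 h3 h4 => fun_ineq_real hct h1 h2 h3 h4, ?_⟩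
  · rw [hPr] at hPp
    exact pos_of_mul_pos_left hPp hvr.le
  · intro x hx
    by_cases hxA : x ∈ A
    · exact Or.inl hxA
    · right
      have hxf : x ∈ frontier A ∩ frontier E := by
        refine ⟨?_, ?_⟩
        · rw [hAopen.frontier_eq]
          exact ⟨closure_mono hs hx, hxA⟩
        · refine ⟨hx, fun h => hxA (hs (interior_subset h))⟩
      simp only [Finite.coe_toFinset]
      exact ⟨hxf, mem_closure_of_null hAopen h0 hxf (hreg hxf)⟩
  · intro q hq
    rw [Finite.mem_toFinset] at hq
    exact hreg hq.1

lemma int_on {E : Set (Euc 2)} (hb : IsBounded E) {F : Type*} [NormedAddCommGroup F]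
    {f : Euc 2 → F} (hf : Continuous f) : IntegrableOn f E :=
  (hf.continuousOn.integrableOn_compact hb.isCompact_closure).mono_set subset_closure

/-- the standard bump -/
def bb : ContDiffBump (0 : Euc 2) := ⟨1, 2, by norm_num, by norm_num⟩

/-- scaled bump centered at `q` -/
def bmp (q : Euc 2) (δ : ℝ) (x : Euc 2) : ℝ := bb (δ⁻¹ • (x - q))

lemma bmp_contDiff (q : Euc 2) (δ : ℝ) : ContDiff ℝ (⊤ : ℕ∞) (bmp q δ) :=
  bb.contDiff.comp ((contDiff_id.sub contDiff_const).const_smul δ⁻¹)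

lemma bmp_nonneg (q : Euc 2) (δ : ℝ) (x : Euc 2) : 0 ≤ bmp q δ x := bb.nonneg
lemma bmp_le_one (q : Euc 2) (δ : ℝ) (x : Euc 2) : bmp q δ x ≤ 1 := bb.le_one

lemma bmp_one {q : Euc 2} {δ : ℝ} (hδ : 0 < δ) {x : Euc 2} (hx : dist x q ≤ δ) :
    bmp q δ x = 1 := by
  refine bb.one_of_mem_closedBall ?_
  rw [mem_closedBall_zero_iff, norm_smul, norm_inv, Real.norm_eq_abs, abs_of_pos hδ,
    inv_mul_le_iff₀ hδ, ← dist_eq_norm]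
  simpa [bb] using hx

lemma bmp_zero {q : Euc 2} {δ : ℝ} (hδ : 0 < δ) {x : Euc 2} (hx : 2 * δ ≤ dist x q) :
    bmp q δ x = 0 := by
  refine bb.zero_of_le_dist ?_
  rw [dist_zero_right, norm_smul, norm_inv, Real.norm_eq_abs, abs_of_pos hδ,
    ← dist_eq_norm, inv_mul_eq_div, le_div_iff₀ hδ]
  exact hx

lemma bmp_support {q : Euc 2} {δ : ℝ} (hδ : 0 < δ) :
    tsupport (bmp q δ) ⊆ closedBall q (2 * δ) := by
  refine closure_minimal ?_ isClosed_closedBall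
  intro x hx
  by_contra h
  exact hx (bmp_zero hδ (not_le.1 h).le)

lemma bmp_compSupp {q : Euc 2} {δ : ℝ} (hδ : 0 < δ) : HasCompactSupport (bmp q δ) :=
  (isCompact_closedBall q (2 * δ)).of_isClosed_subset (isClosed_tsupport _) (bmp_support hδ)

lemma exists_bmp_bound : ∃ M : ℝ, 0 < M ∧ ∀ (q : Euc 2) (δ : ℝ), 0 < δ → ∀ x,
    ‖gradient (bmp q δ) x‖ ≤ M / δ := by
  have hb1 : ContDiff ℝ 1 bb := bb.contDiff
  obtain ⟨C, hC⟩ := (hb1.continuous_fderiv one_ne_zero).bounded_above_of_compact_support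
    (bb.hasCompactSupport.fderiv ℝ)
  have hC0 : 0 ≤ C := (norm_nonneg _).trans (hC 0)
  refine ⟨C + 1, by linarith, fun q δ hδ x => ?_⟩
  rw [norm_grad]
  have hd : HasFDerivAt (bmp q δ)
      ((fderiv ℝ bb (δ⁻¹ • (x - q))).comp (δ⁻¹ • ContinuousLinearMap.id ℝ (Euc 2))) x := by
    refine HasFDerivAt.comp x (hb1.differentiable one_ne_zero _).hasFDerivAt ?_
    exact ((hasFDerivAt_id x).sub_const q).const_smul δ⁻¹
  rw [hd.fderiv]
  calc _ ≤ ‖fderiv ℝ bb (δ⁻¹ • (x - q))‖ * ‖δ⁻¹ • ContinuousLinearMap.id ℝ (Euc 2)‖ :=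
        ContinuousLinearMap.opNorm_comp_le _ _
    _ ≤ (C + 1) * δ⁻¹ := by
        have h1 : ‖δ⁻¹ • ContinuousLinearMap.id ℝ (Euc 2)‖ ≤ δ⁻¹ := by
          rw [norm_smul, norm_inv, Real.norm_eq_abs, abs_of_pos hδ]
          have := ContinuousLinearMap.norm_id_le (𝕜 := ℝ) (E := Euc 2)
          have h2 := (inv_pos.2 hδ).le
          nlinarith
        have h3 := hC (δ⁻¹ • (x - q))
        gcongr
        linarith
    _ = _ := by rw [div_eq_mul_inv]

/-- volume of the unit disk -/
def VV : ℝ := volume.real (ball (0 : Euc 2) 1)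

lemma VV_pos : 0 < VV := ENNReal.toReal_pos (measure_ball_pos _ _ one_pos).ne' measure_ball_lt_top.ne

lemma vol_cball (q : Euc 2) {r : ℝ} (hr : 0 ≤ r) : volume.real (closedBall q r) = r ^ 2 * VV := by
  rw [Measure.real, Measure.addHaar_closedBall _ _ hr]
  simp only [finrank_euclideanSpace, Fintype.card_fin, ENNReal.toReal_mul]
  rw [ENNReal.toReal_ofReal (by positivity)]
  rfl

/-- integral bound for functions supported in a ball -/
lemma integral_ball_bound {E : Set (Euc 2)} (_hE : MeasurableSet E) (hb : IsBounded E) {f : Euc 2 → ℝ}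
    (hf : Continuous f) {q : Euc 2} {r C : ℝ} (hr : 0 ≤ r) (hC : 0 ≤ C)
    (h0 : ∀ x, x ∉ closedBall q r → f x = 0) (h1 : ∀ x, f x ≤ C) :
    ∫ x in E, f x ≤ C * (r ^ 2 * VV) := by
  have hm : MeasurableSet (closedBall q r) := isClosed_closedBall.measurableSet
  calc ∫ x in E, f x ≤ ∫ x in E, (closedBall q r).indicator (fun _ => C) x := by
        refine setIntegral_mono (int_on hb hf) ?_ ?_
        · exact (integrableOn_const hb.measure_lt_top.ne).indicator hm
        · intro x
          by_cases hx : x ∈ closedBall q r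
          · simp only [indicator_of_mem hx]; exact h1 x
          · simp only [indicator_of_notMem hx]; exact (h0 x hx).le
    _ = ∫ x in E ∩ closedBall q r, C := setIntegral_indicator hm
    _ = volume.real (E ∩ closedBall q r) * C := by simp
    _ ≤ volume.real (closedBall q r) * C := by
        gcongr
        · exact measure_closedBall_lt_top.ne
        · exact inter_subset_right
    _ = _ := by rw [vol_cball q hr, mul_comm]

/-- cutoff vanishing near `K` -/
def cut (K : Finset (Euc 2)) (δ : ℝ) (x : Euc 2) : ℝ := 1 - ∑ q ∈ K, bmp q δ x

lemma cut_contDiff (K : Finset (Euc 2)) (δ : ℝ) : ContDiff ℝ (⊤ : ℕ∞) (cut K δ) :=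
  contDiff_const.sub (ContDiff.sum fun q _ => bmp_contDiff q δ)

lemma grad_cut (K : Finset (Euc 2)) (δ : ℝ) (x : Euc 2) :
    gradient (cut K δ) x = - ∑ q ∈ K, gradient (bmp q δ) x := by
  have h : ∀ q ∈ K, DifferentiableAt ℝ (bmp q δ) x := fun q _ =>
    (bmp_contDiff q δ).differentiable (by simp) x
  have : fderiv ℝ (cut K δ) x = - ∑ q ∈ K, fderiv ℝ (bmp q δ) x := by
    have h1 : HasFDerivAt (fun y => ∑ q ∈ K, bmp q δ y) (∑ q ∈ K, fderiv ℝ (bmp q δ) x) x :=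
      HasFDerivAt.fun_sum fun q hq => (h q hq).hasFDerivAt
    exact (h1.const_sub 1).fderiv
  simp [gradient, this]

/-- separation of the points of `K` -/
def PtSep (K : Finset (Euc 2)) (δ : ℝ) : Prop := ∀ p ∈ K, ∀ q ∈ K, p ≠ q → 8 * δ < dist p q

lemma sep_eventually (K : Finset (Euc 2)) : ∀ᶠ δ : ℝ in 𝓝[>] 0, PtSep K δ := by
  unfold PtSep
  rw [Filter.eventually_all_finset]
  intro p _
  rw [Filter.eventually_all_finset]
  intro q _
  by_cases hpq : p = q
  · simp [hpq]
  · have : 0 < dist p q := dist_pos.2 hpq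
    filter_upwards [Ioo_mem_nhdsGT (show (0 : ℝ) < dist p q / 8 by positivity)] with δ hδ _
    linarith [hδ.2]

lemma sum_bmp_eq {K : Finset (Euc 2)} {δ : ℝ} (hδ : 0 < δ) (hs : PtSep K δ) {q : Euc 2} (hq : q ∈ K)
    {x : Euc 2} (hx : dist x q < 4 * δ) : ∑ p ∈ K, bmp p δ x = bmp q δ x := by
  refine Finset.sum_eq_single_of_mem q hq fun p hp hpq => ?_
  refine bmp_zero hδ ?_
  have h1 := hs p hp q hq hpq
  have h2 := dist_triangle_left p q x
  linarith

lemma cut_mem {K : Finset (Euc 2)} {δ : ℝ} (hδ : 0 < δ) (hs : PtSep K δ) (x : Euc 2) :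
    0 ≤ cut K δ x ∧ cut K δ x ≤ 1 := by
  constructor
  · unfold cut
    by_cases h : ∃ q ∈ K, dist x q < 4 * δ
    · obtain ⟨q, hq, hx⟩ := h
      rw [sum_bmp_eq hδ hs hq hx]
      linarith [bmp_le_one q δ x]
    · push Not at h
      rw [Finset.sum_eq_zero fun q hq => bmp_zero hδ (by linarith [h q hq])]
      norm_num
  · unfold cut
    linarith [Finset.sum_nonneg fun q (_ : q ∈ K) => bmp_nonneg q δ x]

lemma cut_zero {K : Finset (Euc 2)} {δ : ℝ} (hδ : 0 < δ) (hs : PtSep K δ) {q : Euc 2} (hq : q ∈ K)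
    {x : Euc 2} (hx : dist x q ≤ δ) : cut K δ x = 0 := by
  unfold cut
  rw [sum_bmp_eq hδ hs hq (by linarith), bmp_one hδ hx, sub_self]

lemma one_le_top' : (1 : WithTop ℕ∞) ≤ ((⊤ : ℕ∞) : WithTop ℕ∞) := by exact_mod_cast le_top

lemma exists_cut_bounds (K : Finset (Euc 2)) : ∃ C : ℝ, 0 < C ∧ ∀ (E : Set (Euc 2)),
    MeasurableSet E → IsBounded E → ∀ δ, 0 < δ →
    ∫ x in E, ‖gradient (cut K δ) x‖ ≤ C * δ ∧ ∫ x in E, (1 - cut K δ x) ≤ C * δ ^ 2 := by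
  obtain ⟨M, hM, hMb⟩ := exists_bmp_bound
  have hV := VV_pos
  refine ⟨(K.card * (M * (4 * VV)) + K.card * (4 * VV)) + 1, by positivity, fun E hE hb δ hδ => ⟨?_, ?_⟩⟩
  · have hcg : ∀ q, Continuous (fun x => ‖gradient (bmp q δ) x‖) := fun q =>
      (cont_grad ((bmp_contDiff q δ).of_le one_le_top')).norm
    calc ∫ x in E, ‖gradient (cut K δ) x‖ ≤ ∫ x in E, ∑ q ∈ K, ‖gradient (bmp q δ) x‖ := by
          refine setIntegral_mono (int_on hb ?_) (int_on hb ?_) fun x => ?_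
          · exact (cont_grad ((cut_contDiff K δ).of_le one_le_top')).norm
          · exact continuous_finsetSum _ fun q _ => hcg q
          · simp only [grad_cut, norm_neg]; exact norm_sum_le _ _
      _ = ∑ q ∈ K, ∫ x in E, ‖gradient (bmp q δ) x‖ :=
          integral_finsetSum _ fun q _ => int_on hb (hcg q)
      _ ≤ ∑ q ∈ K, M / δ * ((2 * δ) ^ 2 * VV) := by
          refine Finset.sum_le_sum fun q _ => ?_
          refine integral_ball_bound (q := q) hE hb (hcg q) (by positivity) (by positivity) ?_ (hMb q δ hδ)
          intro x hx
          rw [grad_zero_of_notMem fun h => hx (bmp_support hδ h), norm_zero]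
      _ = (K.card * (M * (4 * VV))) * δ := by
          rw [Finset.sum_const, nsmul_eq_mul]; field_simp; ring
      _ ≤ _ := by
          gcongr
          have : 0 ≤ (K.card : ℝ) * (4 * VV) := by positivity
          linarith
  · have hcg : ∀ q, Continuous (bmp q δ) := fun q => (bmp_contDiff q δ).continuous
    calc ∫ x in E, (1 - cut K δ x) = ∫ x in E, ∑ q ∈ K, bmp q δ x := by simp [cut]
      _ = ∑ q ∈ K, ∫ x in E, bmp q δ x :=
          integral_finsetSum _ fun q _ => int_on hb (hcg q)
      _ ≤ ∑ q ∈ K, 1 * ((2 * δ) ^ 2 * VV) := by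
          refine Finset.sum_le_sum fun q _ => ?_
          refine integral_ball_bound (q := q) hE hb (hcg q) (by positivity) (by positivity) ?_ (bmp_le_one q δ)
          intro x hx
          exact bmp_zero hδ (not_le.1 hx).le
      _ = (K.card * (4 * VV)) * δ ^ 2 := by
          rw [Finset.sum_const, nsmul_eq_mul]; ring
      _ ≤ _ := by
          gcongr
          have : 0 ≤ (K.card : ℝ) * (M * (4 * VV)) := by positivity
          linarith

section
variable {A E : Set (Euc 2)} {K : Finset (Euc 2)} {u : ℕ → Euc 2 → ℝ} {h : ℝ}

lemma Ctx.bddE (c : Ctx A E K u h) : IsBounded E := c.bddA.subset c.sub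

lemma Ctx.smooth1 (c : Ctx A E K u h) (k : ℕ) : ContDiff ℝ 1 (u k) :=
  (c.mol.smooth k).of_le one_le_top'

lemma Ctx.thick (c : Ctx A E K u h) {δ : ℝ} (hδ : 0 < δ) :
    ∃ ε > 0, cthickening ε E ⊆ A ∪ ⋃ q ∈ K, ball q δ := by
  have ho : IsOpen (A ∪ ⋃ q ∈ K, ball q δ) :=
    c.openA.union (isOpen_biUnion fun q _ => isOpen_ball)
  have hsub : closure E ⊆ A ∪ ⋃ q ∈ K, ball q δ := by
    intro x hx
    rcases c.clos hx with h | h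
    · exact Or.inl h
    · exact Or.inr (mem_biUnion h (mem_ball_self hδ))
  obtain ⟨ε, hε, h1⟩ := c.bddE.isCompact_closure.exists_cthickening_subset_open ho hsub
  exact ⟨ε, hε, by rwa [cthickening_closure] at h1⟩

lemma Ctx.supp_small (c : Ctx A E K u h) {ε : ℝ} (hε : 0 < ε) :
    ∀ᶠ k in atTop, Function.support (u k) ⊆ cthickening ε E := by
  filter_upwards [(tendsto_one_div_add_atTop_nhds_zero_nat (𝕜 := ℝ)).eventually (gt_mem_nhds hε)] with k hk
  exact (c.mol.supp k).trans (cthickening_mono hk.le E)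

lemma Ctx.supp_cut (c : Ctx A E K u h) {δ : ℝ} (hδ : 0 < δ) :
    ∀ᶠ k in atTop, ∀ x, u k x ≠ 0 → x ∈ A ∨ ∃ q ∈ K, dist x q < δ := by
  obtain ⟨ε, hε, h1⟩ := c.thick hδ
  filter_upwards [c.supp_small hε] with k hk x hx
  rcases h1 (hk hx) with h | h
  · exact Or.inl h
  · right
    simpa using h

lemma Ctx.exists_beta (c : Ctx A E K u h) {ε : ℝ} (hε : 0 < ε) :
    ∃ β : Euc 2 → ℝ, ∃ δ : ℝ, 0 < δ ∧ ContDiff ℝ (⊤ : ℕ∞) β ∧ (∀ x, 0 ≤ β x) ∧ (∀ x, β x ≤ 1) ∧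
      (∀ q ∈ K, ∀ x, dist x q ≤ δ → β x = 0) ∧
      ∫ x in E, ‖gradient β x‖ < ε ∧ ∫ x in E, (1 - β x) < ε := by
  obtain ⟨C, hC, hCb⟩ := exists_cut_bounds K
  have t1 : Tendsto (fun δ : ℝ => C * δ) (𝓝[>] 0) (𝓝 0) := by
    have : Tendsto (fun δ : ℝ => C * δ) (𝓝 0) (𝓝 (C * 0)) := (continuous_const.mul continuous_id).tendsto 0
    rw [mul_zero] at this
    exact this.mono_left nhdsWithin_le_nhds
  have t2 : Tendsto (fun δ : ℝ => C * δ ^ 2) (𝓝[>] 0) (𝓝 0) := by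
    have : Tendsto (fun δ : ℝ => C * δ ^ 2) (𝓝 0) (𝓝 (C * 0 ^ 2)) :=
      (continuous_const.mul (continuous_id.pow 2)).tendsto 0
    rw [zero_pow two_ne_zero, mul_zero] at this
    exact this.mono_left nhdsWithin_le_nhds
  obtain ⟨δ, h1, h2, h3, hδ⟩ := ((t1.eventually (gt_mem_nhds hε)).and
    ((t2.eventually (gt_mem_nhds hε)).and ((sep_eventually K).and
      (self_mem_nhdsWithin : Ioi (0 : ℝ) ∈ 𝓝[>] 0)))).exists
  have hδ : 0 < δ := hδ
  obtain ⟨b1, b2⟩ := hCb E c.measE c.bddE δ hδ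
  exact ⟨cut K δ, δ, hδ, cut_contDiff K δ, fun x => (cut_mem hδ h3 x).1, fun x => (cut_mem hδ h3 x).2,
    fun q hq x hx => cut_zero hδ h3 hq hx, b1.trans_lt h1, b2.trans_lt h2⟩

end

section
variable {A E : Set (Euc 2)} {K : Finset (Euc 2)} {u : ℕ → Euc 2 → ℝ} {h : ℝ}

lemma Ctx.int_u_mul (c : Ctx A E K u h) (k : ℕ) {ψ : Euc 2 → ℝ} (hψ : Continuous ψ) :
    Integrable (fun x => u k x * ψ x) :=
  integrable_cc ((c.mol.smooth k).continuous.mul hψ) (c.mol.compSupp k).mul_right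

lemma Ctx.int_grad_mul (c : Ctx A E K u h) (k : ℕ) {ψ : Euc 2 → ℝ} (hψ : Continuous ψ) :
    Integrable (fun x => ψ x * ‖gradient (u k) x‖) :=
  integrable_cc (hψ.mul (cont_grad (c.smooth1 k)).norm) (compSupp_grad (c.mol.compSupp k)).norm.mul_left

lemma Ctx.I1 (c : Ctx A E K u h) {ζ : Euc 2 → ℝ} (hζ : ContDiff ℝ 1 ζ) (h0 : ∀ x, 0 ≤ ζ x)
    (h1 : ∀ x, ζ x ≤ 1) {ε : ℝ} (hε : 0 < ε) :
    ∀ᶠ k in atTop, ∫ x, ζ x * ‖gradient (u k) x‖ ≤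
      (∫ x in E, ‖gradient ζ x‖) + h * (∫ x in E, ζ x) + ε := by
  have hh := c.hpos
  obtain ⟨β, δ, hδ, hβ, hβ0, hβ1, hβz, hb1, hb2⟩ :=
    c.exists_beta (show 0 < ε / (2 * (1 + h)) by positivity)
  have hβ' : ContDiff ℝ 1 β := hβ.of_le one_le_top'
  let θ : Euc 2 → ℝ := fun x => (1 - ζ x) * β x
  have hθ : ContDiff ℝ 1 θ := (contDiff_const.sub hζ).mul hβ'
  have hζd : ∀ x, DifferentiableAt ℝ ζ x := hζ.differentiable one_ne_zero
  have hgθ : ∀ x, ‖gradient θ x‖ ≤ ‖gradient ζ x‖ + ‖gradient β x‖ := by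
    intro x
    have e1 : gradient (fun y => 1 - ζ y) x = - gradient ζ x := by
      have : fderiv ℝ (fun y => 1 - ζ y) x = - fderiv ℝ ζ x := fderiv_const_sub 1
      simp [gradient, this]
    have e2 : gradient θ x = (1 - ζ x) • gradient β x + β x • gradient (fun y => 1 - ζ y) x :=
      grad_mul ((hζd x).const_sub 1) (hβ'.differentiable one_ne_zero x)
    rw [e2, e1]
    calc _ ≤ ‖(1 - ζ x) • gradient β x‖ + ‖β x • -gradient ζ x‖ := norm_add_le _ _
      _ = (1 - ζ x) * ‖gradient β x‖ + β x * ‖gradient ζ x‖ := by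
          rw [norm_smul, norm_smul, norm_neg, Real.norm_of_nonneg (hβ0 x),
            Real.norm_of_nonneg (by linarith [h1 x])]
      _ ≤ 1 * ‖gradient β x‖ + 1 * ‖gradient ζ x‖ := by
          gcongr
          · linarith [h0 x]
          · exact hβ1 x
      _ = _ := by ring
  have hcζ := (cont_grad hζ).norm
  have hcβ := (cont_grad hβ').norm
  -- the functional inequality
  have hineq : ∀ᶠ k in atTop, ∫ x, ζ x * ‖gradient (u k) x‖ ≤
      (∫ x, u k x * (‖gradient ζ x‖ + ‖gradient β x‖)) + h * volume.real E - h * ∫ x, u k x * θ x := by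
    filter_upwards [c.supp_cut hδ] with k hk
    have hu := c.smooth1 k
    have F := c.fun_ineq (fun x => u k x * θ x) (hu.mul hθ) (c.mol.compSupp k).mul_right
      (fun x hx => by
        have hx' : u k x ≠ 0 ∧ θ x ≠ 0 := mul_ne_zero_iff.1 hx
        rcases hk x hx'.1 with h2 | ⟨q, hq, h2⟩
        · exact h2
        · exact absurd (by simp [θ, hβz q hq x h2.le]) hx'.2)
      (fun x => mul_nonneg (c.mol.nonneg k x) (mul_nonneg (by linarith [h1 x]) (hβ0 x)))
    have G : ∫ x, ‖gradient (fun x => u k x * θ x) x‖ ≤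
        ∫ x, (u k x * (‖gradient ζ x‖ + ‖gradient β x‖) + (1 * ‖gradient (u k) x‖ -
          ζ x * ‖gradient (u k) x‖)) := by
      refine integral_mono ?_ ?_ fun x => ?_
      · exact integrable_cc (cont_grad (hu.mul hθ)).norm
          (compSupp_grad (c.mol.compSupp k).mul_right).norm
      · exact (c.int_u_mul k (hcζ.add hcβ)).add
          ((c.int_grad_mul k continuous_const).sub (c.int_grad_mul k hζ.continuous))
      · simp only
        rw [grad_mul (hu.differentiable one_ne_zero x) (hθ.differentiable one_ne_zero x)]
        have hθ0 : 0 ≤ θ x := mul_nonneg (by linarith [h1 x]) (hβ0 x)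
        have hθ1 : θ x ≤ 1 - ζ x := mul_le_of_le_one_right (by linarith [h1 x]) (hβ1 x)
        calc _ ≤ ‖u k x • gradient θ x‖ + ‖θ x • gradient (u k) x‖ := norm_add_le _ _
          _ = u k x * ‖gradient θ x‖ + θ x * ‖gradient (u k) x‖ := by
              rw [norm_smul, norm_smul, Real.norm_of_nonneg hθ0, Real.norm_of_nonneg (c.mol.nonneg k x)]
          _ ≤ u k x * (‖gradient ζ x‖ + ‖gradient β x‖) + (1 - ζ x) * ‖gradient (u k) x‖ := by
              gcongr
              · exact c.mol.nonneg k x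
              · exact hgθ x
          _ = _ := by ring
    have i1 : Integrable (fun x => u k x * (‖gradient ζ x‖ + ‖gradient β x‖)) :=
      c.int_u_mul k (hcζ.add hcβ)
    have i2 : Integrable (fun x => 1 * ‖gradient (u k) x‖) := c.int_grad_mul k continuous_const
    have i3 : Integrable (fun x => ζ x * ‖gradient (u k) x‖) := c.int_grad_mul k hζ.continuous
    have i4 : Integrable (fun x => 1 * ‖gradient (u k) x‖ - ζ x * ‖gradient (u k) x‖) := i2.sub i3
    rw [integral_add i1 i4, integral_sub i2 i3] at G
    have P := c.mol.grad_le k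
    rw [c.perim] at P
    simp only [one_mul] at G
    linarith
  have L := ((c.mol.lim _ (hcζ.add hcβ)).add_const (h * volume.real E)).sub
    ((c.mol.lim _ hθ.continuous).const_mul h)
  have hb := c.bddE
  have hlt : (∫ x in E, (‖gradient ζ x‖ + ‖gradient β x‖)) + h * volume.real E - h * ∫ x in E, θ x <
      (∫ x in E, ‖gradient ζ x‖) + h * (∫ x in E, ζ x) + ε := by
    have e1 : ∫ x in E, (‖gradient ζ x‖ + ‖gradient β x‖) =
        (∫ x in E, ‖gradient ζ x‖) + ∫ x in E, ‖gradient β x‖ :=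
      integral_add (int_on hb hcζ) (int_on hb hcβ)
    have e2 : ∫ x in E, (1 - (ζ x + (1 - β x))) ≤ ∫ x in E, θ x := by
      refine setIntegral_mono (int_on hb ?_) (int_on hb hθ.continuous) fun x => ?_
      · exact continuous_const.sub (hζ.continuous.add (continuous_const.sub hβ.continuous))
      · simp only [θ]
        nlinarith [h0 x, h1 x, hβ0 x, hβ1 x, mul_nonneg (h0 x) (sub_nonneg.2 (hβ1 x))]
    have c1 : IntegrableOn (fun x => 1 - β x) E := int_on hb (continuous_const.sub hβ.continuous)
    have e3 : ∫ x in E, (1 - (ζ x + (1 - β x))) = volume.real E - ((∫ x in E, ζ x) + ∫ x in E, (1 - β x)) := by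
      have c2 : IntegrableOn (fun x => ζ x + (1 - β x)) E := (int_on hb hζ.continuous).add c1
      rw [integral_sub (int_on hb continuous_const) c2,
        integral_add (int_on hb hζ.continuous) c1]
      simp
    rw [e3] at e2
    have e4 := mul_le_mul_of_nonneg_left e2 hh.le
    have e5 := mul_lt_mul_of_pos_left hb2 hh
    have e6 : ε / (2 * (1 + h)) + h * (ε / (2 * (1 + h))) = ε / 2 := by field_simp
    rw [e1]
    nlinarith
  filter_upwards [hineq, L.eventually (gt_mem_nhds hlt)] with k h2 h3
  exact h2.trans h3.le

/-- upper density estimate -/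
lemma Ctx.I3 (c : Ctx A E K u h) : ∃ C : ℝ, 0 < C ∧ ∀ q : Euc 2, ∀ r : ℝ, 0 < r → r ≤ 1 →
    ∀ᶠ k in atTop, ∫ x in closedBall q r, ‖gradient (u k) x‖ ≤ C * r := by
  obtain ⟨M, hM, hMb⟩ := exists_bmp_bound
  have hV := VV_pos
  have hh := c.hpos
  refine ⟨M * (4 * VV) + h * (4 * VV) + 1, by positivity, fun q r hr hr1 => ?_⟩
  have hb1 : ContDiff ℝ 1 (bmp q r) := (bmp_contDiff q r).of_le one_le_top'
  filter_upwards [c.I1 hb1 (bmp_nonneg q r) (bmp_le_one q r) hr] with k hk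
  have e1 : ∫ x in closedBall q r, ‖gradient (u k) x‖ ≤ ∫ x, bmp q r x * ‖gradient (u k) x‖ := by
    rw [← integral_indicator isClosed_closedBall.measurableSet]
    refine integral_mono_of_nonneg (ae_of_all _ fun x => ?_)
      (c.int_grad_mul k hb1.continuous) (ae_of_all _ fun x => ?_)
    · exact indicator_nonneg (fun _ _ => norm_nonneg _) _
    · by_cases hx : x ∈ closedBall q r
      · simp only [indicator_of_mem hx]
        rw [bmp_one hr hx, one_mul]
      · simp only [indicator_of_notMem hx]
        exact mul_nonneg (bmp_nonneg _ _ _) (norm_nonneg _)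
  have e2 : ∫ x in E, ‖gradient (bmp q r) x‖ ≤ M / r * ((2 * r) ^ 2 * VV) := by
    refine integral_ball_bound (q := q) c.measE c.bddE (cont_grad hb1).norm (by positivity)
      (by positivity) ?_ (hMb q r hr)
    intro x hx
    rw [grad_zero_of_notMem fun h => hx (bmp_support hr h), norm_zero]
  have e3 : ∫ x in E, bmp q r x ≤ 1 * ((2 * r) ^ 2 * VV) := by
    refine integral_ball_bound (q := q) c.measE c.bddE hb1.continuous (by positivity)
      (by positivity) ?_ (bmp_le_one q r)
    intro x hx
    exact bmp_zero hr (not_le.1 hx).le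
  have e4 : M / r * ((2 * r) ^ 2 * VV) = M * (4 * VV) * r := by field_simp; ring
  have e5 := mul_le_mul_of_nonneg_left e3 hh.le
  have e6 : h * (1 * ((2 * r) ^ 2 * VV)) ≤ h * (4 * VV) * r := by
    have : h * (1 * ((2 * r) ^ 2 * VV)) = h * (4 * VV) * (r * r) := by ring
    rw [this]
    have : r * r ≤ r := by nlinarith
    gcongr
  linarith

end

lemma exists_frame {ν : Euc 2} (hν : ‖ν‖ = 1) : ∃ τ : Euc 2, ‖τ‖ = 1 ∧ ⟪τ, ν⟫ = 0 ∧
    ∀ z : Euc 2, ‖z‖ ^ 2 = ⟪z, τ⟫ ^ 2 + ⟪z, ν⟫ ^ 2 := by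
  have h1 : ν 0 ^ 2 + ν 1 ^ 2 = 1 := by
    have := EuclideanSpace.norm_sq_eq ν
    rw [hν] at this
    simp [Fin.sum_univ_two] at this
    linarith
  refine ⟨!₂[-ν 1, ν 0], ?_, ?_, ?_⟩
  · rw [EuclideanSpace.norm_eq]
    simp [Fin.sum_univ_two]
    linarith
  · simp [PiLp.inner_apply, Fin.sum_univ_two]
    ring
  · intro z
    rw [EuclideanSpace.norm_sq_eq]
    simp [PiLp.inner_apply, Fin.sum_univ_two]
    calc z 0 ^ 2 + z 1 ^ 2 = (z 0 ^ 2 + z 1 ^ 2) * (ν 0 ^ 2 + ν 1 ^ 2) := by rw [h1, mul_one]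
      _ = _ := by ring

lemma exists_st_bound : ∃ M : ℝ, 0 < M ∧ ∀ x, deriv Real.smoothTransition x ≤ M := by
  have : HasCompactSupport (deriv Real.smoothTransition) :=
    HasCompactSupport.intro (isCompact_Icc (a := (0 : ℝ)) (b := 1)) fun x hx => by
      apply st_deriv_zero
      by_contra h
      push Not at h
      exact hx h
  obtain ⟨C, hC⟩ := st_deriv_cont.bounded_above_of_compact_support this
  exact ⟨|C| + 1, by positivity, fun x => (le_abs_self _).trans ((hC x).trans
    ((le_abs_self C).trans (by linarith)))⟩

/-- normalised coordinate -/
def yc (p : Euc 2) (r : ℝ) (ν x : Euc 2) : ℝ := r⁻¹ * ⟪x - p, ν⟫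

def zta (p : Euc 2) (r L : ℝ) (τ ν x : Euc 2) : ℝ :=
  Real.smoothTransition (yc p r ν x + 3 - (yc p r τ x) ^ 2 / L ^ 2) *
    Real.smoothTransition (2 - yc p r ν x)

lemma yc_contDiff (p : Euc 2) (r : ℝ) (ν : Euc 2) : ContDiff ℝ 1 (yc p r ν) :=
  contDiff_const.mul ((contDiff_id.sub contDiff_const).inner ℝ contDiff_const)

lemma grad_yc (p : Euc 2) (r : ℝ) (ν x : Euc 2) : gradient (yc p r ν) x = r⁻¹ • ν := by
  have h1 : HasFDerivAt (yc p r ν) (r⁻¹ • (innerSL ℝ ν)) x := by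
    have h2 : HasFDerivAt (fun y : Euc 2 => (innerSL ℝ ν) (y - p)) (innerSL ℝ ν) x := by
      have := (innerSL ℝ ν).hasFDerivAt (x := x - p)
      exact this.comp x ((hasFDerivAt_id x).sub_const p)
    have h3 := h2.const_mul r⁻¹
    refine h3.congr_of_eventuallyEq (Eventually.of_forall fun y => ?_)
    simp [yc, real_inner_comm]
  refine ext_inner_right ℝ fun v => ?_
  rw [inner_grad, h1.fderiv]
  simp [inner_smul_left]

lemma zta_contDiff (p : Euc 2) (r L : ℝ) (τ ν : Euc 2) : ContDiff ℝ 1 (zta p r L τ ν) := by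
  unfold zta
  refine (st_contDiff.comp ?_).mul (st_contDiff.comp ?_)
  · exact ((yc_contDiff p r ν).add contDiff_const).sub (((yc_contDiff p r τ).pow 2).div_const _)
  · exact contDiff_const.sub (yc_contDiff p r ν)

lemma grad_zta (p : Euc 2) (r L : ℝ) (τ ν x : Euc 2) :
    gradient (zta p r L τ ν) x =
      r⁻¹ • ((deriv Real.smoothTransition (yc p r ν x + 3 - (yc p r τ x) ^ 2 / L ^ 2) *
        Real.smoothTransition (2 - yc p r ν x)) • (ν - (2 * yc p r τ x / L ^ 2) • τ) -
       (Real.smoothTransition (yc p r ν x + 3 - (yc p r τ x) ^ 2 / L ^ 2) *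
        deriv Real.smoothTransition (2 - yc p r ν x)) • ν) := by
  have d1 : ∀ ν : Euc 2, DifferentiableAt ℝ (yc p r ν) x := fun ν =>
    (yc_contDiff p r ν).differentiable one_ne_zero x
  have ds : ∀ t, DifferentiableAt ℝ Real.smoothTransition t := st_contDiff.differentiable one_ne_zero
  have da : DifferentiableAt ℝ (fun y => yc p r ν y + 3 - (yc p r τ y) ^ 2 / L ^ 2) x :=
    (((yc_contDiff p r ν).add contDiff_const).sub
      (((yc_contDiff p r τ).pow 2).div_const _)).differentiable one_ne_zero x
  have db : DifferentiableAt ℝ (fun y => 2 - yc p r ν y) x := (d1 ν).const_sub 2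
  have ga : gradient (fun y => yc p r ν y + 3 - (yc p r τ y) ^ 2 / L ^ 2) x =
      r⁻¹ • (ν - (2 * yc p r τ x / L ^ 2) • τ) := by
    refine ext_inner_right ℝ fun v => ?_
    have hF : HasFDerivAt (fun y => yc p r ν y + 3 - (L ^ 2)⁻¹ * (yc p r τ y) ^ 2)
        (fderiv ℝ (yc p r ν) x - (L ^ 2)⁻¹ • ((2 : ℕ) • yc p r τ x ^ (2 - 1)) • fderiv ℝ (yc p r τ) x) x :=
      ((d1 ν).hasFDerivAt.add_const 3).sub (((d1 τ).hasFDerivAt.pow 2).const_mul _)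
    have hF2 : (fun y => yc p r ν y + 3 - (yc p r τ y) ^ 2 / L ^ 2) =
        fun y => yc p r ν y + 3 - (L ^ 2)⁻¹ * (yc p r τ y) ^ 2 := by
      ext y; ring
    rw [inner_grad, hF2, hF.fderiv]
    simp only [sub_apply, smul_apply, ← inner_grad, grad_yc,
      inner_smul_left, inner_sub_left]
    simp
    ring
  have gb : gradient (fun y => 2 - yc p r ν y) x = - (r⁻¹ • ν) := by
    rw [← grad_yc p r ν x]
    have : fderiv ℝ (fun y => 2 - yc p r ν y) x = - fderiv ℝ (yc p r ν) x := fderiv_const_sub 2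
    simp [gradient, this]
  unfold zta
  rw [grad_mul (f := fun y => Real.smoothTransition (yc p r ν y + 3 - (yc p r τ y) ^ 2 / L ^ 2))
    (g := fun y => Real.smoothTransition (2 - yc p r ν y)) ((ds _).comp x da) ((ds _).comp x db),
    grad_comp da (ds _), grad_comp db (ds _), ga, gb]
  module

lemma norm_frame {τ ν : Euc 2} (hν : ‖ν‖ = 1) (hτ : ‖τ‖ = 1) (ho : ⟪τ, ν⟫ = 0) (c : ℝ) :
    ‖ν - c • τ‖ ≤ 1 + c ^ 2 / 2 ∧ ‖ν - c • τ‖ ≤ 1 + |c| := by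
  constructor
  · refine abs_le_of_sq_le_sq' ?_ (by positivity) |>.2
    rw [norm_sub_sq_real, norm_smul, inner_smul_right, real_inner_comm, ho, hν, hτ]
    simp
    nlinarith [sq_nonneg (c ^ 2)]
  · calc _ ≤ ‖ν‖ + ‖c • τ‖ := norm_sub_le _ _
      _ = _ := by rw [norm_smul, hν, hτ, mul_one, Real.norm_eq_abs]

/-- pointwise bounds -/
lemma zta_bounds {M : ℝ} (hM : 0 < M) (hMb : ∀ x, deriv Real.smoothTransition x ≤ M)
    {p : Euc 2} {r L : ℝ} (hr : 0 < r) (hL : 1 ≤ L) {τ ν : Euc 2} (hν : ‖ν‖ = 1) (hτ : ‖τ‖ = 1)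
    (ho : ⟪τ, ν⟫ = 0) (x : Euc 2) :
    (yc p r ν x ≤ 0 → ‖gradient (zta p r L τ ν) x‖ - ⟪gradient (zta p r L τ ν) x, ν⟫ ≤ 6 * M / (L ^ 2 * r)) ∧
    (yc p r ν x ≤ 0 → ¬ (|yc p r τ x| ≤ 3 * L ∧ |yc p r ν x| ≤ 3) →
      ‖gradient (zta p r L τ ν) x‖ - ⟪gradient (zta p r L τ ν) x, ν⟫ ≤ 0) ∧
    (‖gradient (zta p r L τ ν) x‖ - ⟪gradient (zta p r L τ ν) x, ν⟫ ≤ 16 * M / r) ∧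
    (¬ (|yc p r τ x| ≤ 3 * L ∧ |yc p r ν x| ≤ 3) →
      ‖gradient (zta p r L τ ν) x‖ - ⟪gradient (zta p r L τ ν) x, ν⟫ ≤ 0 ∧ zta p r L τ ν x = 0) := by
  have hL2 : 0 < L ^ 2 := by positivity
  rw [grad_zta]
  unfold zta
  set y1 := yc p r τ x
  set y2 := yc p r ν x
  set a := y2 + 3 - y1 ^ 2 / L ^ 2 with ha
  set b := 2 - y2 with hb
  set c := 2 * y1 / L ^ 2 with hc
  have hri := inv_pos.2 hr
  have sa0 := Real.smoothTransition.nonneg a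
  have sb0 := Real.smoothTransition.nonneg b
  have sa1 := Real.smoothTransition.le_one a
  have sb1 := Real.smoothTransition.le_one b
  have da0 := st_deriv_nonneg a
  have db0 := st_deriv_nonneg b
  have da1 := hMb a
  have db1 := hMb b
  -- region bounds
  have reg : 0 ≤ a → 0 ≤ b → y1 ^ 2 ≤ 5 * L ^ 2 ∧ -3 ≤ y2 ∧ y2 ≤ 2 := by
    intro h1 h2
    have : 0 ≤ y1 ^ 2 / L ^ 2 := by positivity
    have h3 : y1 ^ 2 / L ^ 2 ≤ 5 := by linarith
    rw [div_le_iff₀ hL2] at h3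
    exact ⟨h3, by linarith, by linarith⟩
  have reg3 : y1 ^ 2 ≤ 5 * L ^ 2 → |y1| ≤ 3 * L := by
    intro h1
    apply abs_le_of_sq_le_sq _ (by positivity)
    nlinarith
  have out : ¬ (|y1| ≤ 3 * L ∧ |y2| ≤ 3) → a < 0 ∨ b < 0 := by
    intro h1
    by_contra h2
    push Not at h2
    obtain ⟨r1, r2, r3⟩ := reg h2.1 h2.2
    exact h1 ⟨reg3 r1, abs_le.2 ⟨r2, by linarith⟩⟩
  set α := deriv Real.smoothTransition a * Real.smoothTransition b with hα
  set γ := Real.smoothTransition a * deriv Real.smoothTransition b with hγ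
  have hα0 : 0 ≤ α := mul_nonneg da0 sb0
  have hγ0 : 0 ≤ γ := mul_nonneg sa0 db0
  have hαM : α ≤ M := by nlinarith
  have hγM : γ ≤ M := by nlinarith
  have hout : a < 0 ∨ b < 0 → α = 0 ∧ γ = 0 ∧ Real.smoothTransition a * Real.smoothTransition b = 0 := by
    rintro (h | h)
    · have e1 := Real.smoothTransition.zero_of_nonpos h.le
      have e2 := st_deriv_zero (Or.inl h)
      simp [hα, hγ, e1, e2]
    · have e1 := Real.smoothTransition.zero_of_nonpos h.le
      have e2 := st_deriv_zero (Or.inl h)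
      simp [hα, hγ, e1, e2]
  have hin : ∀ w : Euc 2, ‖r⁻¹ • w‖ - ⟪r⁻¹ • w, ν⟫ = r⁻¹ * (‖w‖ - ⟪w, ν⟫) := by
    intro w
    rw [norm_smul, inner_smul_left, Real.norm_of_nonneg hri.le]
    simp; ring
  rw [hin]
  have hcν : ⟪ν - c • τ, ν⟫ = 1 := by
    rw [inner_sub_left, inner_smul_left, ho, real_inner_self_eq_norm_sq, hν]; simp
  have hzero : ¬ (|y1| ≤ 3 * L ∧ |y2| ≤ 3) →
      r⁻¹ * (‖α • (ν - c • τ) - γ • ν‖ - ⟪α • (ν - c • τ) - γ • ν, ν⟫) ≤ 0 := by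
    intro h1
    obtain ⟨e1, e2, -⟩ := hout (out h1)
    simp [e1, e2]
  have hcb : α * ‖ν - c • τ‖ ≤ α * 7 := by
    by_cases hab : a < 0 ∨ b < 0
    · simp [(hout hab).1]
    · push Not at hab
      gcongr
      refine (norm_frame hν hτ ho c).2.trans ?_
      have h3 := reg3 (reg hab.1 hab.2).1
      have : |c| ≤ 6 := by
        rw [hc, abs_div, abs_mul, abs_of_pos hL2, div_le_iff₀ hL2]
        simp only [Nat.abs_ofNat]
        nlinarith
      linarith
  refine ⟨fun hy => ?_, fun _ h1 => hzero h1, ?_, fun h1 => ⟨hzero h1, (hout (out h1)).2.2⟩⟩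
  · have hb1 : 1 < b := by linarith
    have hg : γ = 0 := by simp [hγ, st_deriv_zero (Or.inr hb1)]
    rw [hg, zero_smul, sub_zero, norm_smul, inner_smul_left, hcν, Real.norm_of_nonneg hα0]
    simp only [conj_trivial]
    have : α * (‖ν - c • τ‖ - 1) ≤ M * (6 / L ^ 2) := by
      by_cases hab : a < 0 ∨ b < 0
      · rw [(hout hab).1]; simp; positivity
      · push Not at hab
        have h3 : y1 ^ 2 ≤ 3 * L ^ 2 := by
          have h3 : y1 ^ 2 / L ^ 2 ≤ 3 := by linarith
          rwa [div_le_iff₀ hL2] at h3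
        have h4 : c ^ 2 / 2 ≤ 6 / L ^ 2 := by
          rw [hc, div_pow, div_div, div_le_div_iff₀ (by positivity) (by positivity)]
          nlinarith [mul_le_mul_of_nonneg_left h3 (sq_nonneg L)]
        have h5 := (norm_frame hν hτ ho c).1
        have h6 : ‖ν - c • τ‖ - 1 ≤ 6 / L ^ 2 := by linarith
        calc α * (‖ν - c • τ‖ - 1) ≤ α * (6 / L ^ 2) := by gcongr
          _ ≤ _ := by gcongr
    calc r⁻¹ * (α * ‖ν - c • τ‖ - α * 1) = r⁻¹ * (α * (‖ν - c • τ‖ - 1)) := by ring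
      _ ≤ r⁻¹ * (M * (6 / L ^ 2)) := by gcongr
      _ = _ := by field_simp
  · have hn : ‖α • (ν - c • τ) - γ • ν‖ ≤ 8 * M := by
      calc _ ≤ ‖α • (ν - c • τ)‖ + ‖γ • ν‖ := norm_sub_le _ _
        _ = α * ‖ν - c • τ‖ + γ := by
            rw [norm_smul, norm_smul, hν, Real.norm_of_nonneg hα0, Real.norm_of_nonneg hγ0, mul_one]
        _ ≤ _ := by linarith
    have hn2 := abs_real_inner_le_norm (α • (ν - c • τ) - γ • ν) ν
    rw [hν, mul_one] at hn2
    have := neg_abs_le ⟪α • (ν - c • τ) - γ • ν, ν⟫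
    calc _ ≤ r⁻¹ * (16 * M) := by gcongr; linarith
      _ = _ := by field_simp

def strip (p : Euc 2) (r L : ℝ) (τ ν : Euc 2) : Set (Euc 2) :=
  {x | |yc p r τ x| ≤ 3 * L ∧ |yc p r ν x| ≤ 3}

lemma strip_closed (p : Euc 2) (r L : ℝ) (τ ν : Euc 2) : IsClosed (strip p r L τ ν) :=
  (isClosed_le (yc_contDiff p r τ).continuous.abs continuous_const).inter
    (isClosed_le (yc_contDiff p r ν).continuous.abs continuous_const)

lemma strip_sub_ball {p : Euc 2} {r L : ℝ} (hr : 0 < r) (hL : 1 ≤ L) {τ ν : Euc 2}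
    (hz : ∀ z : Euc 2, ‖z‖ ^ 2 = ⟪z, τ⟫ ^ 2 + ⟪z, ν⟫ ^ 2) :
    strip p r L τ ν ⊆ ball p (5 * L * r) := by
  rintro x ⟨h1, h2⟩
  rw [mem_ball, dist_eq_norm]
  have e1 : ∀ w : Euc 2, ⟪x - p, w⟫ = r * yc p r w x := fun w => by
    unfold yc; field_simp
  apply abs_lt_of_sq_lt_sq _ (by positivity) |>.trans_le' (le_abs_self _)
  rw [hz, e1, e1]
  have h3 := sq_le_sq' (abs_le.1 h1).1 (abs_le.1 h1).2
  have h4 := sq_le_sq' (abs_le.1 h2).1 (abs_le.1 h2).2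
  have h5 : yc p r τ x ^ 2 + yc p r ν x ^ 2 < 25 * L ^ 2 := by nlinarith
  have h6 := mul_lt_mul_of_pos_left h5 (show 0 < r ^ 2 by positivity)
  nlinarith

lemma strip_vol {p : Euc 2} {r : ℝ} {N : ℕ} (hr : 0 < r) (hN : 1 ≤ N) {τ ν : Euc 2}
    (hτ : ‖τ‖ = 1) (ho : ⟪τ, ν⟫ = 0)
    (hz : ∀ z : Euc 2, ‖z‖ ^ 2 = ⟪z, τ⟫ ^ 2 + ⟪z, ν⟫ ^ 2) :
    volume.real (strip p r N τ ν) ≤ 112 * N * r ^ 2 * VV := by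
  have hcov : strip p r N τ ν ⊆ ⋃ j ∈ Finset.Icc (-(3 * N : ℤ)) (3 * N),
      closedBall (p + (r * j) • τ) (4 * r) := by
    rintro x ⟨h1, h2⟩
    refine mem_biUnion (x := ⌊yc p r τ x⌋) ?_ ?_
    · have h3 := abs_le.1 h1
      simp only [Finset.coe_Icc, mem_Icc]
      constructor
      · rw [Int.le_floor]; push_cast; linarith
      · have := (Int.floor_le (yc p r τ x)).trans h3.2
        exact_mod_cast this
    · rw [mem_closedBall, dist_eq_norm]
      set j : ℤ := ⌊yc p r τ x⌋
      have e1 : ∀ w : Euc 2, ⟪x - p, w⟫ = r * yc p r w x := fun w => by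
        unfold yc; field_simp
      have e2 : x - (p + (r * (j : ℝ)) • τ) = (x - p) - (r * (j : ℝ)) • τ := by abel
      refine (le_abs_self _).trans (abs_le_of_sq_le_sq ?_ (by positivity))
      rw [e2, hz, inner_sub_left (x - p) _ τ, inner_sub_left (x - p) _ ν, inner_smul_left, inner_smul_left, e1, e1, ho,
        real_inner_self_eq_norm_sq, hτ]
      simp only [conj_trivial, one_pow, mul_one, mul_zero, sub_zero]
      have f1 : 0 ≤ yc p r τ x - j := by linarith [Int.floor_le (yc p r τ x)]
      have f2 : yc p r τ x - j ≤ 1 := by linarith [Int.lt_floor_add_one (yc p r τ x)]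
      have h4 := sq_le_sq' (abs_le.1 h2).1 (abs_le.1 h2).2
      have f3 : (yc p r τ x - j) ^ 2 + yc p r ν x ^ 2 ≤ 16 := by nlinarith
      have f4 := mul_le_mul_of_nonneg_left f3 (sq_nonneg r)
      nlinarith
  calc volume.real (strip p r N τ ν)
      ≤ volume.real (⋃ j ∈ Finset.Icc (-(3 * N : ℤ)) (3 * N),
          closedBall (p + (r * j) • τ) (4 * r)) := by
        refine measureReal_mono hcov ?_
        refine (measure_biUnion_lt_top (Finset.finite_toSet _) fun j _ => ?_).ne
        exact measure_closedBall_lt_top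
    _ ≤ ∑ j ∈ Finset.Icc (-(3 * N : ℤ)) (3 * N),
          volume.real (closedBall (p + (r * j) • τ) (4 * r)) := measureReal_biUnion_finset_le _ _
    _ = ((6 * N + 1 : ℕ) : ℝ) * ((4 * r) ^ 2 * VV) := by
        rw [Finset.sum_congr rfl fun j _ => vol_cball _ (by positivity), Finset.sum_const, nsmul_eq_mul,
          Int.card_Icc]
        congr 2
        omega
    _ ≤ (7 * N) * ((4 * r) ^ 2 * VV) := by
        have := VV_pos
        gcongr
        push_cast
        have : (1 : ℝ) ≤ N := by exact_mod_cast hN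
        linarith
    _ = _ := by ring

section
variable {A E : Set (Euc 2)} {K : Finset (Euc 2)} {u : ℕ → Euc 2 → ℝ} {h : ℝ}

lemma Ctx.int_dir (c : Ctx A E K u h) (k : ℕ) {ψ : Euc 2 → ℝ} (hψ : Continuous ψ) (ν : Euc 2) :
    Integrable (fun x => ψ x * ⟪gradient (u k) x, ν⟫) := by
  refine integrable_cc (hψ.mul ((cont_grad (c.smooth1 k)).inner continuous_const)) ?_
  refine (compSupp_grad (c.mol.compSupp k)).mono fun x hx hx2 => hx ?_
  simp [hx2]

lemma Ctx.ibp_dir (c : Ctx A E K u h) (k : ℕ) {ψ : Euc 2 → ℝ} (hψ : ContDiff ℝ 1 ψ) (ν : Euc 2) :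
    ∫ x, ψ x * ⟪gradient (u k) x, ν⟫ = - ∫ x, u k x * ⟪gradient ψ x, ν⟫ := by
  simp only [inner_grad]
  rw [ibp_scalar hψ (c.smooth1 k) (c.mol.compSupp k) ν]
  simp only [mul_comm]

/-- excess inequality for a general test function -/
lemma Ctx.excess (c : Ctx A E K u h) {ζ : Euc 2 → ℝ} (hζ : ContDiff ℝ 1 ζ) (h0 : ∀ x, 0 ≤ ζ x)
    (h1 : ∀ x, ζ x ≤ 1) (ν : Euc 2) {ε : ℝ} (hε : 0 < ε) :
    ∀ᶠ k in atTop, ∫ x, ζ x * (‖gradient (u k) x‖ + ⟪gradient (u k) x, ν⟫) ≤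
      (∫ x in E, (‖gradient ζ x‖ - ⟪gradient ζ x, ν⟫)) + h * (∫ x in E, ζ x) + ε := by
  have hcd : Continuous (fun x => ⟪gradient ζ x, ν⟫) := (cont_grad hζ).inner continuous_const
  have L := (c.mol.lim _ hcd).neg
  have hlt : -(∫ x in E, ⟪gradient ζ x, ν⟫) < -(∫ x in E, ⟪gradient ζ x, ν⟫) + ε / 2 := by linarith
  filter_upwards [c.I1 hζ h0 h1 (half_pos hε), L.eventually (gt_mem_nhds hlt)] with k h2 h3
  simp only [mul_add]
  rw [integral_add (c.int_grad_mul k hζ.continuous) (c.int_dir k hζ.continuous ν), c.ibp_dir k hζ ν,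
    integral_sub (int_on c.bddE (cont_grad hζ).norm) (int_on c.bddE hcd)]
  linarith

lemma blowup_small {A : Set (Euc 2)} {p ν : Euc 2} (hb : blowsUpTo A p ν) {κ R : ℝ} (hκ : 0 < κ)
    (hR : 0 < R) : ∀ᶠ r : ℝ in 𝓝[>] 0,
      volume.real (symmDiff A {y : Euc 2 | ⟪y - p, ν⟫ ≤ 0} ∩ ball p (R * r)) ≤ κ * (R * r) ^ 2 := by
  have t : Tendsto (fun r : ℝ => R * r) (𝓝[>] 0) (𝓝[>] 0) := by
    refine tendsto_nhdsWithin_iff.2 ⟨?_, ?_⟩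
    · have : Tendsto (fun r : ℝ => R * r) (𝓝 0) (𝓝 (R * 0)) :=
        (continuous_const.mul continuous_id).tendsto 0
      rw [mul_zero] at this
      exact this.mono_left nhdsWithin_le_nhds
    · filter_upwards [self_mem_nhdsWithin] with r hr
      exact mul_pos hR hr
  have := (hb.2.comp t).eventually (gt_mem_nhds (ENNReal.ofReal_pos.2 hκ))
  filter_upwards [this, self_mem_nhdsWithin] with r h1 hr
  have hr : 0 < r := hr
  have hpos : ENNReal.ofReal ((R * r) ^ 2) ≠ 0 := by
    simp only [ne_eq, ENNReal.ofReal_eq_zero, not_le]; positivity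
  have h2 := (ENNReal.div_lt_iff (Or.inl hpos) (Or.inl ENNReal.ofReal_ne_top)).1 h1
  rw [← ENNReal.ofReal_mul hκ.le] at h2
  exact ENNReal.toReal_le_of_le_ofReal (by positivity) h2.le

lemma Ctx.I2 (c : Ctx A E K u h) {p ν : Euc 2} (hb : blowsUpTo A p ν) {κ : ℝ} (hκ : 0 < κ) :
    ∀ᶠ r : ℝ in 𝓝[>] 0, ∀ᶠ k in atTop,
      ∫ x in closedBall p r, (‖gradient (u k) x‖ + ⟪gradient (u k) x, ν⟫) ≤ κ * r := by
  obtain ⟨M, hM, hMb⟩ := exists_st_bound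
  have hV := VV_pos
  have hh := c.hpos
  have hν := hb.1
  obtain ⟨τ, hτ, ho, hz⟩ := exists_frame hν
  obtain ⟨N, hN⟩ := exists_nat_gt (4 * (672 * M * VV) / κ)
  have hNpos : 0 < (N : ℝ) := lt_of_le_of_lt (by positivity) hN
  have hN1 : 1 ≤ N := by exact_mod_cast hNpos
  have hL : (1 : ℝ) ≤ N := by exact_mod_cast hN1
  rw [div_lt_iff₀ hκ] at hN
  have hκ' : 0 < κ / (4 * (400 * M * (N : ℝ) ^ 2)) := by positivity
  have hR : 0 < 5 * (N : ℝ) := by positivity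
  have hrs : 0 < κ / (4 * (h * (25 * (N : ℝ) ^ 2 * VV))) := by positivity
  filter_upwards [blowup_small hb hκ' hR, Ioo_mem_nhdsGT hrs] with r hbl hr
  obtain ⟨hr, hr2⟩ := hr
  set ζ := zta p r N τ ν with hζdef
  have hζ : ContDiff ℝ 1 ζ := zta_contDiff p r N τ ν
  have h0 : ∀ x, 0 ≤ ζ x := fun x =>
    mul_nonneg (Real.smoothTransition.nonneg _) (Real.smoothTransition.nonneg _)
  have h1 : ∀ x, ζ x ≤ 1 := fun x =>
    mul_le_one₀ (Real.smoothTransition.le_one _) (Real.smoothTransition.nonneg _)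
      (Real.smoothTransition.le_one _)
  have hone : ∀ x ∈ closedBall p r, ζ x = 1 := by
    intro x hx
    rw [mem_closedBall, dist_eq_norm] at hx
    have e1 : ∀ w : Euc 2, ‖w‖ = 1 → |yc p r w x| ≤ 1 := by
      intro w hw
      unfold yc
      have := abs_real_inner_le_norm (x - p) w
      rw [hw, mul_one] at this
      rw [abs_mul, abs_of_pos (inv_pos.2 hr), inv_mul_le_iff₀ hr]
      linarith
    have a1 := abs_le.1 (e1 ν hν)
    have a2 := (sq_le_one_iff_abs_le_one _).2 (e1 τ hτ)
    have a3 : yc p r τ x ^ 2 / (N : ℝ) ^ 2 ≤ 1 := by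
      rw [div_le_one (by positivity)]; nlinarith
    simp only [hζdef, zta]
    rw [Real.smoothTransition.one_of_one_le (by linarith [a1.1]),
      Real.smoothTransition.one_of_one_le (by linarith [a1.2]), one_mul]
  have hbd := zta_bounds hM hMb hr hL hν hτ ho (p := p)
  set S := strip p r N τ ν with hS
  have hSm : MeasurableSet S := (strip_closed p r N τ ν).measurableSet
  have hSball : S ⊆ ball p (5 * N * r) := strip_sub_ball hr hL hz
  let U : Set (Euc 2) := {x | 0 < yc p r ν x}
  have hUm : MeasurableSet U := (isOpen_lt continuous_const (yc_contDiff p r ν).continuous).measurableSet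
  have hEfin : volume E ≠ ⊤ := c.bddE.measure_lt_top.ne
  have hcd : Continuous (fun x => ⟪gradient ζ x, ν⟫) := (cont_grad hζ).inner continuous_const
  have hcf : Continuous (fun x => ‖gradient ζ x‖ - ⟪gradient ζ x, ν⟫) := (cont_grad hζ).norm.sub hcd
  -- main bound
  have b1 : ∫ x in E, (‖gradient ζ x‖ - ⟪gradient ζ x, ν⟫) ≤
      6 * M / (N ^ 2 * r) * (112 * N * r ^ 2 * VV) +
      16 * M / r * (κ / (4 * (400 * M * (N : ℝ) ^ 2)) * (5 * N * r) ^ 2) := by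
    calc ∫ x in E, (‖gradient ζ x‖ - ⟪gradient ζ x, ν⟫)
        ≤ ∫ x in E, (S.indicator (fun _ => 6 * M / (N ^ 2 * r)) x +
            (S ∩ U).indicator (fun _ => 16 * M / r) x) := by
          refine setIntegral_mono (int_on c.bddE hcf) ?_ fun x => ?_
          · exact ((integrableOn_const hEfin).indicator hSm).add
              ((integrableOn_const hEfin).indicator (hSm.inter hUm))
          · obtain ⟨q1, q2, q3, q4⟩ := hbd x
            have pos1 : 0 < 6 * M / ((N : ℝ) ^ 2 * r) := by positivity
            simp only
            by_cases hxS : x ∈ S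
            · by_cases hxU : x ∈ U
              · rw [indicator_of_mem hxS, indicator_of_mem (show x ∈ S ∩ U from ⟨hxS, hxU⟩)]
                linarith
              · rw [indicator_of_mem hxS, indicator_of_notMem (fun hx => hxU hx.2)]
                have := q1 (not_lt.1 hxU)
                linarith
            · rw [indicator_of_notMem hxS, indicator_of_notMem (fun hx => hxS hx.1)]
              have := (q4 hxS).1
              linarith
      _ = volume.real (E ∩ S) * (6 * M / (N ^ 2 * r)) + volume.real (E ∩ (S ∩ U)) * (16 * M / r) := by
          have j1 : Integrable (S.indicator fun _ => 6 * M / ((N : ℝ) ^ 2 * r)) (volume.restrict E) :=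
            (integrableOn_const hEfin).indicator hSm
          have j2 : Integrable ((S ∩ U).indicator fun _ => 16 * M / r) (volume.restrict E) :=
            (integrableOn_const hEfin).indicator (hSm.inter hUm)
          rw [integral_add j1 j2,
            setIntegral_indicator hSm, setIntegral_indicator (hSm.inter hUm)]
          simp
      _ ≤ (112 * N * r ^ 2 * VV) * (6 * M / (N ^ 2 * r)) +
          (κ / (4 * (400 * M * (N : ℝ) ^ 2)) * (5 * N * r) ^ 2) * (16 * M / r) := by
          gcongr
          · refine (measureReal_mono inter_subset_right ?_).trans (strip_vol hr hN1 hτ ho hz)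
            exact ((measure_mono hSball).trans_lt measure_ball_lt_top).ne
          · refine (measureReal_mono ?_ ?_).trans hbl
            · rintro x ⟨hxE, hxS, hxU⟩
              refine ⟨Or.inl ⟨c.sub hxE, ?_⟩, hSball hxS⟩
              simp only [mem_setOf_eq, not_le]
              have hxU : 0 < r⁻¹ * ⟪x - p, ν⟫ := hxU
              exact pos_of_mul_pos_right hxU (inv_pos.2 hr).le
            · exact ((measure_mono inter_subset_right).trans_lt measure_ball_lt_top).ne
      _ = _ := by ring
  have b2 : ∫ x in E, ζ x ≤ 1 * ((5 * N * r) ^ 2 * VV) := by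
    refine integral_ball_bound (q := p) c.measE c.bddE hζ.continuous (by positivity) (by positivity) ?_ h1
    intro x hx
    exact ((hbd x).2.2.2 fun hxS => hx (ball_subset_closedBall (hSball hxS))).2
  have b3 : 6 * M / ((N : ℝ) ^ 2 * r) * (112 * N * r ^ 2 * VV) ≤ κ / 4 * r := by
    have : 6 * M / ((N : ℝ) ^ 2 * r) * (112 * N * r ^ 2 * VV) = (672 * M * VV) / N * r := by
      field_simp; ring
    rw [this]
    refine mul_le_mul_of_nonneg_right ?_ hr.le
    rw [div_le_iff₀ hNpos]
    linarith
  have b4 : 16 * M / r * (κ / (4 * (400 * M * (N : ℝ) ^ 2)) * (5 * N * r) ^ 2) = κ / 4 * r := by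
    field_simp; ring
  have b5 : h * (1 * ((5 * N * r) ^ 2 * VV)) ≤ κ / 4 * r := by
    rw [lt_div_iff₀ (by positivity)] at hr2
    nlinarith
  filter_upwards [c.excess hζ h0 h1 ν (show 0 < κ / 4 * r by positivity)] with k hk
  have e1 : ∫ x in closedBall p r, (‖gradient (u k) x‖ + ⟪gradient (u k) x, ν⟫) ≤
      ∫ x, ζ x * (‖gradient (u k) x‖ + ⟪gradient (u k) x, ν⟫) := by
    have hnn : ∀ x, 0 ≤ ‖gradient (u k) x‖ + ⟪gradient (u k) x, ν⟫ := by
      intro x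
      have := abs_real_inner_le_norm (gradient (u k) x) ν
      rw [hν, mul_one] at this
      linarith [(abs_le.1 this).1]
    rw [← integral_indicator isClosed_closedBall.measurableSet]
    refine integral_mono_of_nonneg (ae_of_all _ fun x => ?_) ?_ (ae_of_all _ fun x => ?_)
    · exact indicator_nonneg (fun x _ => hnn x) _
    · simp only [mul_add]
      exact (c.int_grad_mul k hζ.continuous).add (c.int_dir k hζ.continuous ν)
    · by_cases hx : x ∈ closedBall p r
      · simp only [indicator_of_mem hx]
        rw [hone x hx, one_mul]
      · simp only [indicator_of_notMem hx]
        exact mul_nonneg (h0 x) (hnn x)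
  have b6 := mul_le_mul_of_nonneg_left b2 hh.le
  linarith

end

lemma det_rank_one (a : ℝ) (φ : Euc 2 →L[ℝ] ℝ) (X : Euc 2) :
    (a • ContinuousLinearMap.id ℝ (Euc 2) + φ.smulRight X).det = a * (a + φ X) := by
  have hX : φ X = X 0 * φ (EuclideanSpace.single 0 1) + X 1 * φ (EuclideanSpace.single 1 1) := by
    have : X = X 0 • EuclideanSpace.single (0 : Fin 2) (1 : ℝ) +
        X 1 • EuclideanSpace.single (1 : Fin 2) (1 : ℝ) := by
      ext i; fin_cases i <;> simp
    conv_lhs => rw [this]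
    simp
  rw [hX, ContinuousLinearMap.det, ← LinearMap.det_toMatrix (EuclideanSpace.basisFun (Fin 2) ℝ).toBasis,
    Matrix.det_fin_two]
  simp [LinearMap.toMatrix_apply]
  ring

/-- The deformation. -/
def dfm (η : Euc 2 → ℝ) (t : ℝ) (x : Euc 2) : Euc 2 := x + t • (η x • x)

lemma dfm_hasFDerivAt {η : Euc 2 → ℝ} (hη : ContDiff ℝ 1 η) (t : ℝ) (x : Euc 2) :
    HasFDerivAt (dfm η t) ((1 + t * η x) • ContinuousLinearMap.id ℝ (Euc 2) +
      (t • fderiv ℝ η x).smulRight x) x := by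
  have h1 : HasFDerivAt η (fderiv ℝ η x) x := (hη.differentiable one_ne_zero x).hasFDerivAt
  have h2 := (h1.smul (hasFDerivAt_id x)).const_smul t
  have h3 := (hasFDerivAt_id x).add h2
  refine h3.congr_fderiv ?_
  ext1 y
  simp [add_smul, smul_smul, smul_add, add_assoc]

lemma dfm_contDiff {η : Euc 2 → ℝ} (hη : ContDiff ℝ 1 η) (t : ℝ) : ContDiff ℝ 1 (dfm η t) :=
  contDiff_id.add ((hη.smul contDiff_id).const_smul t)

lemma dfm_homeo {η : Euc 2 → ℝ} (hη : ContDiff ℝ 1 η) {t B : ℝ} (ht : 0 ≤ t)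
    (h0 : ∀ x, 0 ≤ η x) (h1 : ∀ x, η x ≤ 1) (hB0 : 0 ≤ B) (hB : ∀ x, ‖gradient η x‖ * ‖x‖ ≤ B)
    (htB : t * (1 + B) ≤ 1 / 2) :
    ∃ e : Euc 2 ≃ₜ Euc 2, (∀ x, e x = dfm η t x) ∧ ContDiff ℝ 1 e.symm := by
  have hd : ∀ x, HasFDerivAt (fun x => dfm η t x - x)
      ((t * η x) • ContinuousLinearMap.id ℝ (Euc 2) + (t • fderiv ℝ η x).smulRight x) x := by
    intro x
    refine ((dfm_hasFDerivAt hη t x).sub (hasFDerivAt_id x)).congr_fderiv ?_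
    ext1 y
    simp [add_smul]
    abel
  have hn : ∀ x, ‖(t * η x) • ContinuousLinearMap.id ℝ (Euc 2) + (t • fderiv ℝ η x).smulRight x‖ ≤ 1 / 2 := by
    intro x
    refine ContinuousLinearMap.opNorm_le_bound _ (by norm_num) fun y => ?_
    have e1 : ((t * η x) • ContinuousLinearMap.id ℝ (Euc 2) + (t • fderiv ℝ η x).smulRight x) y
        = (t * η x) • y + (t * ⟪gradient η x, y⟫) • x := by
      simp [inner_grad]
    rw [e1]
    have i1 := abs_real_inner_le_norm (gradient η x) y
    calc ‖(t * η x) • y + (t * ⟪gradient η x, y⟫) • x‖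
        ≤ t * η x * ‖y‖ + t * |⟪gradient η x, y⟫| * ‖x‖ := by
          refine (norm_add_le _ _).trans ?_
          rw [norm_smul, norm_smul, Real.norm_of_nonneg (mul_nonneg ht (h0 x)), norm_mul,
            Real.norm_of_nonneg ht, Real.norm_eq_abs]
      _ ≤ t * 1 * ‖y‖ + t * (‖gradient η x‖ * ‖y‖) * ‖x‖ := by
          gcongr
          exact h1 x
      _ = t * (1 + ‖gradient η x‖ * ‖x‖) * ‖y‖ := by ring
      _ ≤ t * (1 + B) * ‖y‖ := by
          gcongr
          exact hB x
      _ ≤ 1 / 2 * ‖y‖ := by gcongr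
  have hlip : LipschitzWith (1 / 2) (fun x => dfm η t x - x) := by
    refine lipschitzWith_of_nnnorm_fderiv_le (fun x => (hd x).differentiableAt) fun x => ?_
    rw [(hd x).fderiv]
    have := hn x
    rw [← NNReal.coe_le_coe]
    simpa using this
  have happ : ApproximatesLinearOn (dfm η t) ((ContinuousLinearEquiv.refl ℝ (Euc 2)) : Euc 2 →L[ℝ] Euc 2)
      univ (1 / 2) := by
    refine LipschitzOnWith.approximatesLinearOn ?_
    exact hlip.lipschitzOnWith
  have hc : Subsingleton (Euc 2) ∨ (1 / 2 : ℝ≥0) <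
      ‖((ContinuousLinearEquiv.refl ℝ (Euc 2)).symm : Euc 2 →L[ℝ] Euc 2)‖₊⁻¹ := by
    right
    have : ‖((ContinuousLinearEquiv.refl ℝ (Euc 2)).symm : Euc 2 →L[ℝ] Euc 2)‖₊ = 1 := by
      ext
      exact ContinuousLinearMap.norm_id
    rw [this, inv_one, ← NNReal.coe_lt_coe]
    norm_num
  let e := happ.toHomeomorph (dfm η t) hc
  have he : ∀ x, e x = dfm η t x := fun x => rfl
  refine ⟨e, he, ?_⟩
  have hdet : ∀ x, ((1 + t * η x) • ContinuousLinearMap.id ℝ (Euc 2) +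
      (t • fderiv ℝ η x).smulRight x).det ≠ 0 := by
    intro x
    rw [det_rank_one]
    have i1 := abs_real_inner_le_norm (gradient η x) x
    have i2 := (abs_le.1 (i1.trans (hB x))).1
    have i3 : 0 ≤ t * η x := mul_nonneg ht (h0 x)
    rw [inner_grad] at i2
    have i4 : -(t * B) ≤ t * fderiv ℝ η x x := by nlinarith
    have : (t • fderiv ℝ η x) x = t * fderiv ℝ η x x := by simp
    rw [this]
    have : 0 < 1 + t * η x + t * fderiv ℝ η x x := by nlinarith
    positivity
  refine e.contDiff_symm (f₀' := fun x => ContinuousLinearMap.toContinuousLinearEquivOfDetNeZero _ (hdet x)) ?_ ?_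
  · intro x
    exact dfm_hasFDerivAt hη t x
  · exact dfm_contDiff hη t

/-- cofactor action -/
def cof (η : Euc 2 → ℝ) (t : ℝ) (x v : Euc 2) : Euc 2 :=
  (1 + t * η x + t * ⟪x, gradient η x⟫) • v - (t * ⟪x, v⟫) • gradient η x

def jac (η : Euc 2 → ℝ) (t : ℝ) (x : Euc 2) : ℝ :=
  (1 + t * η x) * (1 + t * η x + t * ⟪x, gradient η x⟫)

lemma dfm_push {A : Set (Euc 2)} {h : ℝ}
    (hA : ∀ w : Euc 2 → ℝ, ContDiff ℝ 1 w → HasCompactSupport w → Function.support w ⊆ A →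
      (∀ x, 0 ≤ w x) → h * ∫ x, w x ≤ ∫ x, ‖gradient w x‖)
    {η : Euc 2 → ℝ} (hη : ContDiff ℝ 1 η) {t B : ℝ} (ht : 0 ≤ t)
    (h0 : ∀ x, 0 ≤ η x) (h1 : ∀ x, η x ≤ 1) (hB0 : 0 ≤ B) (hB : ∀ x, ‖gradient η x‖ * ‖x‖ ≤ B)
    (htB : t * (1 + B) ≤ 1 / 2) {f : Euc 2 → ℝ} (hf : ContDiff ℝ 1 f) (hfc : HasCompactSupport f)
    (hf0 : ∀ x, 0 ≤ f x) (hfA : ∀ x, f x ≠ 0 → dfm η t x ∈ A) :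
    h * ∫ x, f x * jac η t x ≤ ∫ x, ‖cof η t x (gradient f x)‖ := by
  obtain ⟨e, he, hes⟩ := dfm_homeo hη ht h0 h1 hB0 hB htB
  have hfe : ∀ x, f (e.symm (dfm η t x)) = f x := fun x => by rw [← he, e.symm_apply_apply]
  have hw : ContDiff ℝ 1 (f ∘ e.symm) := hf.comp hes
  have main := hA (f ∘ e.symm) hw (hfc.comp_homeomorph e.symm) ?_ (fun x => hf0 _)
  · have hjac : ∀ x, |((1 + t * η x) • ContinuousLinearMap.id ℝ (Euc 2) +
        (t • fderiv ℝ η x).smulRight x).det| = jac η t x := by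
      intro x
      rw [det_rank_one]
      have i1 := abs_real_inner_le_norm (gradient η x) x
      have i2 := (abs_le.1 (i1.trans (hB x))).1
      have i3 : 0 ≤ t * η x := mul_nonneg ht (h0 x)
      have i4 : -(t * B) ≤ t * ⟪gradient η x, x⟫ := by nlinarith
      have : (t • fderiv ℝ η x) x = t * ⟪x, gradient η x⟫ := by
        rw [real_inner_comm, inner_grad]; simp
      rw [this, jac]
      rw [real_inner_comm] at i4
      have : 0 < 1 + t * η x + t * ⟪x, gradient η x⟫ := by nlinarith
      exact abs_of_pos (by positivity)
    have hcv : ∀ g : Euc 2 → ℝ, ∫ y, g y = ∫ x, jac η t x * g (dfm η t x) := by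
      intro g
      have hinj : InjOn (dfm η t) univ := by
        intro x _ y _ hxy
        rw [← he, ← he] at hxy
        exact e.injective hxy
      have := integral_image_eq_integral_abs_det_fderiv_smul volume MeasurableSet.univ
        (fun x _ => (dfm_hasFDerivAt hη t x).hasFDerivWithinAt) hinj g
      have hsurj : dfm η t '' univ = univ := by
        rw [image_univ]
        refine range_eq_univ.2 fun y => ⟨e.symm y, ?_⟩
        rw [← he, e.apply_symm_apply]
      rw [hsurj, setIntegral_univ, setIntegral_univ] at this
      rw [this]
      congr 1 with x
      rw [hjac, smul_eq_mul]
    rw [hcv (f ∘ e.symm), hcv (fun x => ‖gradient (f ∘ e.symm) x‖)] at main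
    simp only [Function.comp_apply, hfe] at main
    have e1 : ∫ x, f x * jac η t x = ∫ x, jac η t x * f x := by
      congr 1 with x; ring
    rw [e1]
    refine main.trans (le_of_eq ?_)
    congr 1 with x
    -- chain rule
    set z := gradient (f ∘ e.symm) (dfm η t x) with hz
    have hgrad : gradient f x = (1 + t * η x) • z + (t * ⟪x, z⟫) • gradient η x := by
      have hcomp : HasFDerivAt f ((fderiv ℝ (f ∘ e.symm) (dfm η t x)).comp
          ((1 + t * η x) • ContinuousLinearMap.id ℝ (Euc 2) + (t • fderiv ℝ η x).smulRight x)) x := by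
        have h3 := ((hw.differentiable one_ne_zero (dfm η t x)).hasFDerivAt).comp x
          (dfm_hasFDerivAt hη t x)
        have h4 : (f ∘ e.symm) ∘ dfm η t = f := by
          ext y; exact hfe y
        rwa [h4] at h3
      refine ext_inner_right ℝ fun y => ?_
      rw [inner_grad, hcomp.fderiv, inner_add_left, inner_smul_left, inner_smul_left, inner_grad η,
        hz, inner_grad, real_inner_comm, inner_grad]
      simp
      ring
    rw [hgrad]
    have : cof η t x ((1 + t * η x) • z + (t * ⟪x, z⟫) • gradient η x) = jac η t x • z := by
      unfold cof jac
      rw [inner_add_right, inner_smul_right, inner_smul_right]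
      module
    rw [this, norm_smul, Real.norm_of_nonneg]
    rw [← hjac]; positivity
  · intro y hy
    have := hfA (e.symm y) hy
    rwa [← he, e.apply_symm_apply] at this

def QQ (X g v : Euc 2) : ℝ := ⟪X, g⟫ * ‖v‖ - ⟪X, v⟫ * ⟪g, v⟫ / ‖v‖

lemma QQ_sum (X v : Euc 2) (K : Finset (Euc 2)) (g : Euc 2 → Euc 2) :
    QQ X (∑ q ∈ K, g q) v = ∑ q ∈ K, QQ X (g q) v := by
  unfold QQ
  rw [inner_sum, sum_inner, Finset.sum_sub_distrib, Finset.sum_mul, Finset.mul_sum, Finset.sum_div]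

lemma cof_bound {η : Euc 2 → ℝ} {t B : ℝ} {x : Euc 2} (ht : 0 ≤ t) (h0 : 0 ≤ η x) (h1 : η x ≤ 1)
    (hB0 : 0 ≤ B) (hB : ‖gradient η x‖ * ‖x‖ ≤ B) (v : Euc 2) :
    ‖cof η t x v‖ ≤ ‖v‖ + t * (‖v‖ + QQ x (gradient η x) v) + (1 + 2 * B) ^ 2 * t ^ 2 * ‖v‖ := by
  by_cases hv : v = 0
  · simp [hv, cof, QQ]
  have hm : 0 < ‖v‖ := norm_pos_iff.2 hv
  set g := gradient η x
  set m := ‖v‖ with hmdef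
  have i1 : |⟪x, g⟫| ≤ B := (abs_real_inner_le_norm x g).trans (by linarith [mul_comm ‖x‖ ‖g‖])
  have i2 : |⟪x, v⟫| ≤ ‖x‖ * m := abs_real_inner_le_norm x v
  set y : Euc 2 := (η x + ⟪x, g⟫) • v - ⟪x, v⟫ • g with hy
  have hcof : cof η t x v = v + t • y := by
    unfold cof; rw [hy]; module
  have hyn : ‖y‖ ≤ (1 + 2 * B) * m := by
    calc ‖y‖ ≤ |η x + ⟪x, g⟫| * m + |⟪x, v⟫| * ‖g‖ := by
          refine (norm_sub_le _ _).trans ?_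
          rw [norm_smul, norm_smul, Real.norm_eq_abs, Real.norm_eq_abs]
      _ ≤ (1 + B) * m + (‖x‖ * m) * ‖g‖ := by
          gcongr
          refine (abs_add_le _ _).trans ?_
          rw [abs_of_nonneg h0]
          gcongr
      _ = (1 + B) * m + (‖g‖ * ‖x‖) * m := by ring
      _ ≤ (1 + B) * m + B * m := by gcongr
      _ = _ := by ring
  have hD : ⟪v, y⟫ = m * (η x * m + QQ x g v) := by
    rw [hy, inner_sub_right, inner_smul_right, inner_smul_right, real_inner_self_eq_norm_sq]
    unfold QQ
    rw [real_inner_comm v g]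
    field_simp
    ring
  have hsq : ‖cof η t x v‖ ^ 2 = m ^ 2 + 2 * t * (m * (η x * m + QQ x g v)) + t ^ 2 * ‖y‖ ^ 2 := by
    rw [hcof, norm_add_sq_real, inner_smul_right, hD, norm_smul, Real.norm_of_nonneg ht]
    ring
  have hy2 : ‖y‖ ^ 2 ≤ ((1 + 2 * B) * m) ^ 2 := by gcongr
  have key : 2 * m * ‖cof η t x v‖ ≤
      2 * m * (m + t * (η x * m + QQ x g v) + (1 + 2 * B) ^ 2 * t ^ 2 * m) := by
    have a1 := sq_nonneg (‖cof η t x v‖ - m)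
    have a2 := mul_le_mul_of_nonneg_left hy2 (sq_nonneg t)
    have a3 : 0 ≤ t ^ 2 * ((1 + 2 * B) * m) ^ 2 := by positivity
    nlinarith
  have key2 := le_of_mul_le_mul_left key (by positivity)
  have : t * (η x * m) ≤ t * m := by
    gcongr
    nlinarith
  linarith

lemma cof_bound3 {η : Euc 2 → ℝ} {t B : ℝ} {x : Euc 2} (ht : 0 ≤ t) (h0 : 0 ≤ η x) (h1 : η x ≤ 1)
    (hB0 : 0 ≤ B) (hB : ‖gradient η x‖ * ‖x‖ ≤ B) (htB : t * (1 + B) ≤ 1 / 2) (v : Euc 2) :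
    ‖cof η t x v‖ ≤ 3 * ‖v‖ := by
  set g := gradient η x with hg
  have i1 : |⟪x, g⟫| ≤ B := (abs_real_inner_le_norm x g).trans (by linarith [mul_comm ‖x‖ ‖g‖])
  have i2 : |⟪x, v⟫| ≤ ‖x‖ * ‖v‖ := abs_real_inner_le_norm x v
  have hv := norm_nonneg v
  calc ‖cof η t x v‖ ≤ |1 + t * η x + t * ⟪x, g⟫| * ‖v‖ + (t * |⟪x, v⟫|) * ‖g‖ := by
          unfold cof
          refine (norm_sub_le _ _).trans ?_
          rw [norm_smul, norm_smul, Real.norm_eq_abs, norm_mul, Real.norm_eq_abs, Real.norm_eq_abs,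
            abs_of_nonneg ht]
    _ ≤ (1 + t * 1 + t * B) * ‖v‖ + (t * (‖x‖ * ‖v‖)) * ‖g‖ := by
          gcongr
          have := abs_le.1 i1
          rw [abs_le]
          constructor <;> nlinarith [mul_nonneg ht h0]
    _ = (1 + t * 1 + t * B) * ‖v‖ + t * (‖g‖ * ‖x‖) * ‖v‖ := by ring
    _ ≤ (1 + t * 1 + t * B) * ‖v‖ + t * B * ‖v‖ := by gcongr
    _ ≤ 3 * ‖v‖ := by nlinarith

lemma QQ_abs (X g v : Euc 2) : QQ X g v ≤ 2 * (‖X‖ * ‖g‖ * ‖v‖) := by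
  by_cases hv : v = 0
  · simp [hv, QQ]
  have hm : 0 < ‖v‖ := norm_pos_iff.2 hv
  have i1 := (abs_le.1 (abs_real_inner_le_norm X g)).2
  have i2 := abs_real_inner_le_norm X v
  have i3 := abs_real_inner_le_norm g v
  have : -(‖X‖ * ‖g‖ * ‖v‖) ≤ ⟪X, v⟫ * ⟪g, v⟫ / ‖v‖ := by
    rw [le_div_iff₀ hm]
    have : |⟪X, v⟫ * ⟪g, v⟫| ≤ (‖X‖ * ‖v‖) * (‖g‖ * ‖v‖) := by
      rw [abs_mul]; gcongr
    linarith [(abs_le.1 this).1]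
  unfold QQ
  nlinarith

lemma QQ_bound {X a f v ν : Euc 2} :
    QQ X f v ≤ 2 * (‖X - a‖ * ‖f‖ * ‖v‖) + ‖v‖ * ⟪a - ⟪a, ν⟫ • ν, f⟫ + (1 + ‖ν‖) * (‖a‖ * ‖f‖ * ‖v + ‖v‖ • ν‖) := by
  have hs : QQ X f v = QQ (X - a) f v + QQ a f v := by
    unfold QQ; rw [inner_sub_left, inner_sub_left]; ring
  rw [hs]
  have h1 := QQ_abs (X - a) f v
  suffices h2 : QQ a f v ≤ ‖v‖ * ⟪a - ⟪a, ν⟫ • ν, f⟫ + (1 + ‖ν‖) * (‖a‖ * ‖f‖ * ‖v + ‖v‖ • ν‖) by linarith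
  by_cases hv : v = 0
  · simp [hv, QQ]
  have hm : 0 < ‖v‖ := norm_pos_iff.2 hv
  set e := v + ‖v‖ • ν with he
  have hae : ⟪a, v⟫ = ⟪a, e⟫ - ‖v‖ * ⟪a, ν⟫ := by
    rw [he, inner_add_right, inner_smul_right]; ring
  have hfe : ⟪f, v⟫ = ⟪f, e⟫ - ‖v‖ * ⟪f, ν⟫ := by
    rw [he, inner_add_right, inner_smul_right]; ring
  have e1 : ⟪a, v⟫ * ⟪f, v⟫ / ‖v‖ =
      ⟪a, e⟫ * ⟪f, v⟫ / ‖v‖ - ⟪a, ν⟫ * ⟪f, e⟫ + ‖v‖ * (⟪a, ν⟫ * ⟪f, ν⟫) := by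
    have : ⟪a, v⟫ * ⟪f, v⟫ / ‖v‖ = ⟪a, e⟫ * ⟪f, v⟫ / ‖v‖ - ⟪a, ν⟫ * ⟪f, v⟫ := by
      rw [hae]; field_simp
    rw [this]
    nth_rw 2 [hfe]
    ring
  have b1 : -(‖a‖ * ‖f‖ * ‖e‖) ≤ ⟪a, e⟫ * ⟪f, v⟫ / ‖v‖ := by
    rw [le_div_iff₀ hm]
    have : |⟪a, e⟫ * ⟪f, v⟫| ≤ (‖a‖ * ‖e‖) * (‖f‖ * ‖v‖) := by
      rw [abs_mul]
      exact mul_le_mul (abs_real_inner_le_norm _ _) (abs_real_inner_le_norm _ _) (abs_nonneg _)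
        (by positivity)
    linarith [(abs_le.1 this).1]
  have b2 : ⟪a, ν⟫ * ⟪f, e⟫ ≤ ‖ν‖ * (‖a‖ * ‖f‖ * ‖e‖) := by
    have : |⟪a, ν⟫ * ⟪f, e⟫| ≤ (‖a‖ * ‖ν‖) * (‖f‖ * ‖e‖) := by
      rw [abs_mul]
      exact mul_le_mul (abs_real_inner_le_norm _ _) (abs_real_inner_le_norm _ _) (abs_nonneg _)
        (by positivity)
    linarith [(abs_le.1 this).2]
  unfold QQ
  rw [e1, inner_sub_left, inner_smul_left, real_inner_comm f ν]
  simp only [conj_trivial]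
  linarith

lemma tilt_bound {v ν : Euc 2} (hν : ‖ν‖ = 1) {l : ℝ} (hl : 0 < l) :
    ‖v + ‖v‖ • ν‖ ≤ l * ‖v‖ + (‖v‖ + ⟪v, ν⟫) / (2 * l) := by
  have h2 : ‖v + ‖v‖ • ν‖ ^ 2 = 2 * ‖v‖ * (‖v‖ + ⟪v, ν⟫) := by
    rw [norm_add_sq_real, inner_smul_right, norm_smul, hν, Real.norm_of_nonneg (norm_nonneg v)]
    ring
  have hd : 0 ≤ ‖v‖ + ⟪v, ν⟫ := by
    have := abs_real_inner_le_norm v ν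
    rw [hν, mul_one] at this
    linarith [(abs_le.1 this).1]
  set d := ‖v‖ + ⟪v, ν⟫
  refine (abs_le_of_sq_le_sq ?_ (by positivity)).trans' (le_abs_self _)
  rw [h2]
  have : (l * ‖v‖ + d / (2 * l)) ^ 2 - 2 * ‖v‖ * d = (l * ‖v‖ - d / (2 * l)) ^ 2 := by
    field_simp; ring
  nlinarith [sq_nonneg (l * ‖v‖ - d / (2 * l))]

/-- symmetric integration by parts -/
lemma ibp_sym {f g : Euc 2 → ℝ} (hf : ContDiff ℝ 2 f) (hg : ContDiff ℝ 2 g)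
    (hc : HasCompactSupport g) (v w : Euc 2) :
    ∫ x, ⟪gradient f x, v⟫ * ⟪gradient g x, w⟫ = ∫ x, ⟪gradient f x, w⟫ * ⟪gradient g x, v⟫ := by
  have hsnd : ∀ a b : Euc 2, ∀ x, fderiv ℝ (fun y => fderiv ℝ f y a) x b = fderiv ℝ (fderiv ℝ f) x b a := by
    intro a b x
    have hd : DifferentiableAt ℝ (fderiv ℝ f) x :=
      (hf.fderiv_right (m := 1) (by norm_num)).differentiable one_ne_zero x
    have := (hd.hasFDerivAt.clm_apply (hasFDerivAt_const a x)).fderiv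
    rw [this]; simp
  have hsymm : ∀ x, fderiv ℝ (fderiv ℝ f) x w v = fderiv ℝ (fderiv ℝ f) x v w := fun x =>
    (hf.contDiffAt.isSymmSndFDerivAt (by simp)) w v
  have hc1 : ∀ a : Euc 2, ContDiff ℝ 1 (fun y => fderiv ℝ f y a) := fun a =>
    (hf.fderiv_right (m := 1) (by norm_num)).clm_apply contDiff_const
  have hg1 : ContDiff ℝ 1 g := hg.of_le (by norm_num)
  simp only [inner_grad]
  rw [ibp_scalar (hc1 v) hg1 hc w, ibp_scalar (hc1 w) hg1 hc v]
  simp only [hsnd, hsymm]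

lemma two_le_top' : (2 : WithTop ℕ∞) ≤ ((⊤ : ℕ∞) : WithTop ℕ∞) := by
  have : ((2 : ℕ∞) : WithTop ℕ∞) ≤ ((⊤ : ℕ∞) : WithTop ℕ∞) := WithTop.coe_le_coe.2 le_top
  exact this

section
variable {A E : Set (Euc 2)} {K : Finset (Euc 2)} {u : ℕ → Euc 2 → ℝ} {h : ℝ}

lemma Ctx.I4q (c : Ctx A E K u h) {q ν : Euc 2} (hb : blowsUpTo A q ν) {ε : ℝ} (hε : 0 < ε) :
    ∀ᶠ r : ℝ in 𝓝[>] 0, ∀ᶠ k in atTop, ∃ F : Euc 2 → ℝ, Integrable F ∧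
      (∀ x, QQ x (-gradient (bmp q r) x) (gradient (u k) x) ≤ F x) ∧ ∫ x, F x ≤ ε := by
  obtain ⟨M, hM, hMb⟩ := exists_bmp_bound
  obtain ⟨C, hC, hI3⟩ := c.I3
  have hν := hb.1
  set ρ : ℝ := ‖q‖ + 1 with hρ
  have hρ0 : 0 < ρ := by positivity
  have hρq : ‖q‖ ≤ ρ := by linarith
  set l : ℝ := ε / (24 * (ρ * M * C)) with hl
  have hl0 : 0 < l := by positivity
  set κ : ℝ := ε / (12 * (ρ * M * (1 + 1 / l))) with hκ
  have hκ0 : 0 < κ := by positivity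
  have t2 : Tendsto (fun r : ℝ => 2 * r) (𝓝[>] 0) (𝓝[>] 0) := by
    refine tendsto_nhdsWithin_iff.2 ⟨?_, ?_⟩
    · have : Tendsto (fun r : ℝ => 2 * r) (𝓝 0) (𝓝 (2 * 0)) :=
        (continuous_const.mul continuous_id).tendsto 0
      rw [mul_zero] at this
      exact this.mono_left nhdsWithin_le_nhds
    · filter_upwards [self_mem_nhdsWithin] with r hr
      exact mul_pos two_pos (show (0 : ℝ) < r from hr)
  have hr0 : 0 < min (1 / 2) (ε / (24 * (M * C))) := lt_min (by norm_num) (by positivity)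
  filter_upwards [t2.eventually (c.I2 hb hκ0), Ioo_mem_nhdsGT hr0] with r hI2 hr
  obtain ⟨hr, hr1⟩ := hr
  have hr2 : r < 1 / 2 := hr1.trans_le (min_le_left _ _)
  have hr3 : r < ε / (24 * (M * C)) := hr1.trans_le (min_le_right _ _)
  filter_upwards [hI2, hI3 q (2 * r) (by positivity) (by linarith)] with k hk2 hk3
  set Λ : ℝ := ρ * (M / r) with hΛ
  have hΛ0 : 0 < Λ := by positivity
  set a' : Euc 2 := q - ⟪q, ν⟫ • ν with ha'
  have ha'n : ‖a'‖ ≤ 2 * ρ := by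
    refine (norm_sub_le _ _).trans ?_
    rw [norm_smul, hν, mul_one, Real.norm_eq_abs]
    have := abs_real_inner_le_norm q ν
    rw [hν, mul_one] at this
    linarith
  have ha'ν : ⟪ν, a'⟫ = 0 := by
    rw [ha', inner_sub_right, inner_smul_right, real_inner_self_eq_norm_sq, hν, real_inner_comm]
    ring
  set v : Euc 2 → Euc 2 := gradient (u k) with hv
  have hd : ∀ x, 0 ≤ ‖v x‖ + ⟪v x, ν⟫ := fun x => by
    have := abs_real_inner_le_norm (v x) ν
    rw [hν, mul_one] at this
    linarith [(abs_le.1 this).1]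
  set Bb : Set (Euc 2) := closedBall q (2 * r) with hBb
  have hBm : MeasurableSet Bb := isClosed_closedBall.measurableSet
  have hb1 : ContDiff ℝ 1 (bmp q r) := (bmp_contDiff q r).of_le one_le_top'
  have hb0 : ∀ x, x ∉ Bb → gradient (bmp q r) x = 0 := fun x hx =>
    grad_zero_of_notMem fun hx' => hx (bmp_support hr hx')
  have hbM : ∀ x, ‖gradient (bmp q r) x‖ ≤ M / r := fun x => hMb q r hr x
  have int1 : Integrable (fun x => ‖v x‖) := by
    simpa using c.int_grad_mul k (ψ := fun _ => 1) continuous_const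
  have int2 : Integrable (fun x => ⟪v x, ν⟫) := by
    have := c.int_dir k (ψ := fun _ => 1) continuous_const ν
    simp only [one_mul] at this
    exact this
  have intd : Integrable (fun x => ‖v x‖ + ⟪v x, ν⟫) := int1.add int2
  have intG : ∀ c1 c2 : ℝ, Integrable (fun x => c1 * ‖v x‖ + c2 * (‖v x‖ + ⟪v x, ν⟫)) := fun c1 c2 =>
    (int1.const_mul c1).add (intd.const_mul c2)
  have hcb : Continuous (fun x => ⟪gradient (bmp q r) x, a'⟫) := (cont_grad hb1).inner continuous_const
  have hcb2 : Continuous (fun x => ⟪gradient (bmp q r) x, ν⟫) := (cont_grad hb1).inner continuous_const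
  have int3 : Integrable (fun x => ⟪gradient (bmp q r) x, a'⟫ * ⟪v x, ν⟫) := c.int_dir k hcb ν
  have int4 : Integrable (fun x => ⟪gradient (bmp q r) x, ν⟫ * ⟪v x, a'⟫) := c.int_dir k hcb2 a'
  have iGint : ∀ c1 c2 : ℝ, 0 ≤ c1 → 0 ≤ c2 →
      ∫ x, Bb.indicator (fun x => c1 * ‖v x‖ + c2 * (‖v x‖ + ⟪v x, ν⟫)) x ≤
        c1 * (C * (2 * r)) + c2 * (κ * (2 * r)) := by
    intro c1 c2 h1 h2
    rw [integral_indicator hBm, integral_add (int1.const_mul c1).integrableOn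
      (intd.const_mul c2).integrableOn, integral_const_mul, integral_const_mul]
    gcongr
  refine ⟨fun x => Bb.indicator (fun x => (4 * M + 2 * Λ * l) * ‖v x‖ +
      (2 * Λ + Λ / l) * (‖v x‖ + ⟪v x, ν⟫)) x + ⟪gradient (bmp q r) x, a'⟫ * ⟪v x, ν⟫,
      ((intG _ _).indicator hBm).add int3, fun x => ?_, ?_⟩
  · beta_reduce
    by_cases hx : x ∈ Bb
    · rw [indicator_of_mem hx]
      have q1 := QQ_bound (X := x) (a := q) (f := -gradient (bmp q r) x) (v := v x) (ν := ν)
      have q2 := tilt_bound (v := v x) hν hl0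
      have q3 : ‖x - q‖ ≤ 2 * r := by rw [← dist_eq_norm]; exact hx
      rw [norm_neg, hν, inner_neg_right, ← ha'] at q1
      have hg := hbM x
      set g := gradient (bmp q r) x
      have s1 : 2 * (‖x - q‖ * ‖g‖ * ‖v x‖) ≤ 4 * M * ‖v x‖ := by
        calc 2 * (‖x - q‖ * ‖g‖ * ‖v x‖) ≤ 2 * (2 * r * (M / r) * ‖v x‖) := by gcongr
          _ = _ := by field_simp; ring
      have s2 : -(‖v x‖ + ⟪v x, ν⟫) * ⟪a', g⟫ ≤ 2 * Λ * (‖v x‖ + ⟪v x, ν⟫) := by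
        have j1 : |⟪a', g⟫| ≤ 2 * Λ := by
          calc |⟪a', g⟫| ≤ ‖a'‖ * ‖g‖ := abs_real_inner_le_norm _ _
            _ ≤ (2 * ρ) * (M / r) := by gcongr
            _ = _ := by rw [hΛ]; ring
        nlinarith [(abs_le.1 j1).1, hd x]
      have s3 : (1 + 1) * (‖q‖ * ‖g‖ * ‖v x + ‖v x‖ • ν‖) ≤
          2 * Λ * (l * ‖v x‖ + (‖v x‖ + ⟪v x, ν⟫) / (2 * l)) := by
        calc (1 + 1) * (‖q‖ * ‖g‖ * ‖v x + ‖v x‖ • ν‖) ≤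
            (1 + 1) * (ρ * (M / r) * (l * ‖v x‖ + (‖v x‖ + ⟪v x, ν⟫) / (2 * l))) := by gcongr
          _ = _ := by rw [hΛ]; ring
      have s4 : 2 * Λ * (l * ‖v x‖ + (‖v x‖ + ⟪v x, ν⟫) / (2 * l)) =
          2 * Λ * l * ‖v x‖ + Λ / l * (‖v x‖ + ⟪v x, ν⟫) := by field_simp
      rw [real_inner_comm a' g]
      linarith
    · rw [indicator_of_notMem hx, hb0 x hx]
      simp [QQ]
  · have e1 : ∫ x, ⟪gradient (bmp q r) x, a'⟫ * ⟪v x, ν⟫ = ∫ x, ⟪gradient (bmp q r) x, ν⟫ * ⟪v x, a'⟫ := by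
      refine ibp_sym ((bmp_contDiff q r).of_le ?_) ((c.mol.smooth k).of_le ?_) (c.mol.compSupp k) a' ν <;>
      exact two_le_top'
    have e2 : ∫ x, ⟪gradient (bmp q r) x, ν⟫ * ⟪v x, a'⟫ ≤
        ∫ x, Bb.indicator (fun x => (2 * Λ * l) * ‖v x‖ + (Λ / l) * (‖v x‖ + ⟪v x, ν⟫)) x := by
      refine integral_mono int4 ((intG _ _).indicator hBm) fun x => ?_
      by_cases hx : x ∈ Bb
      · simp only [indicator_of_mem hx]
        have q2 := tilt_bound (v := v x) hν hl0
        have hg := hbM x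
        set g := gradient (bmp q r) x
        have j0 : ⟪v x, a'⟫ = ⟪v x + ‖v x‖ • ν, a'⟫ := by
          rw [inner_add_left, inner_smul_left, ha'ν]; simp
        calc ⟪g, ν⟫ * ⟪v x, a'⟫ ≤ |⟪g, ν⟫| * |⟪v x, a'⟫| := by rw [← abs_mul]; exact le_abs_self _
          _ ≤ (M / r) * ((l * ‖v x‖ + (‖v x‖ + ⟪v x, ν⟫) / (2 * l)) * (2 * ρ)) := by
              gcongr
              · have := abs_real_inner_le_norm g ν
                rw [hν, mul_one] at this
                linarith
              · rw [j0]
                refine (abs_real_inner_le_norm _ _).trans ?_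
                gcongr
                have := hd x
                positivity
          _ = _ := by rw [hΛ]; field_simp
      · simp only [indicator_of_notMem hx, hb0 x hx]
        simp
    rw [integral_add ((intG _ _).indicator hBm) int3, e1]
    have k1 := iGint (4 * M + 2 * Λ * l) (2 * Λ + Λ / l) (by positivity) (by positivity)
    have k2 := iGint (2 * Λ * l) (Λ / l) (by positivity) (by positivity)
    have f1 : 8 * M * C * r ≤ ε / 3 := by
      rw [lt_div_iff₀ (by positivity)] at hr3
      linarith
    have f2 : 8 * Λ * l * C * r = ε / 3 := by
      rw [hΛ, hl]; field_simp; norm_num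
    have f3 : 4 * Λ * (1 + 1 / l) * κ * r = ε / 3 := by
      rw [hΛ, hκ]
      have : 1 + 1 / l ≠ 0 := by positivity
      generalize 1 + 1 / l = w at *
      field_simp; norm_num
    have f4 : 4 * Λ * (1 + 1 / l) * κ * r = 4 * Λ * κ * r + 4 * (Λ / l) * κ * r := by ring
    linarith

lemma Ctx.I4 (c : Ctx A E K u h) {ε : ℝ} (hε : 0 < ε) :
    ∀ᶠ r : ℝ in 𝓝[>] 0, ∀ᶠ k in atTop, ∃ F : Euc 2 → ℝ, Integrable F ∧
      (∀ x, QQ x (gradient (cut K r) x) (gradient (u k) x) ≤ F x) ∧ ∫ x, F x ≤ ε := by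
  have hε' : 0 < ε / (K.card + 1) := by positivity
  have h1 : ∀ᶠ r : ℝ in 𝓝[>] 0, ∀ q ∈ K, ∀ᶠ k in atTop, ∃ F : Euc 2 → ℝ, Integrable F ∧
      (∀ x, QQ x (-gradient (bmp q r) x) (gradient (u k) x) ≤ F x) ∧ ∫ x, F x ≤ ε / (K.card + 1) := by
    refine (Finset.eventually_all K).2 fun q hq => ?_
    obtain ⟨ν, hb⟩ := c.normal q hq
    exact c.I4q hb hε'
  filter_upwards [h1] with r hr
  filter_upwards [(Finset.eventually_all K).2 hr] with k hk
  choose! F hF1 hF2 hF3 using hk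
  refine ⟨fun x => ∑ q ∈ K, F q x, integrable_finsetSum _ hF1, fun x => ?_, ?_⟩
  · have : gradient (cut K r) x = ∑ q ∈ K, -gradient (bmp q r) x := by
      rw [grad_cut, Finset.sum_neg_distrib]
    rw [this, QQ_sum]
    exact Finset.sum_le_sum fun q hq => hF2 q hq x
  · rw [integral_finsetSum _ hF1]
    calc ∑ q ∈ K, ∫ x, F q x ≤ ∑ q ∈ K, ε / (K.card + 1) := Finset.sum_le_sum hF3
      _ = K.card * (ε / (K.card + 1)) := by rw [Finset.sum_const, nsmul_eq_mul]
      _ ≤ ε := by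
        rw [mul_div_assoc', div_le_iff₀ (by positivity)]
        nlinarith

end

lemma exists_cut_B (K : Finset (Euc 2)) {r : ℝ} (hr : 0 < r) :
    ∃ B : ℝ, 0 ≤ B ∧ ∀ x, ‖gradient (cut K r) x‖ * ‖x‖ ≤ B := by
  obtain ⟨M, hM, hMb⟩ := exists_bmp_bound
  refine ⟨∑ q ∈ K, (M / r) * (‖q‖ + 2 * r), Finset.sum_nonneg fun q _ => by positivity, fun x => ?_⟩
  rw [grad_cut, norm_neg]
  calc ‖∑ q ∈ K, gradient (bmp q r) x‖ * ‖x‖ ≤ (∑ q ∈ K, ‖gradient (bmp q r) x‖) * ‖x‖ := by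
        gcongr; exact norm_sum_le _ _
    _ = ∑ q ∈ K, ‖gradient (bmp q r) x‖ * ‖x‖ := Finset.sum_mul ..
    _ ≤ _ := Finset.sum_le_sum fun q _ => ?_
  by_cases hx : x ∈ closedBall q (2 * r)
  · have h1 := hMb q r hr x
    have h2 : ‖x‖ ≤ ‖q‖ + 2 * r := by
      have := norm_le_norm_add_norm_sub' x q
      rw [mem_closedBall, dist_eq_norm] at hx
      linarith
    gcongr
  · rw [grad_zero_of_notMem fun hx' => hx (bmp_support hr hx')]
    simp only [norm_zero, zero_mul]
    positivity

lemma jac_bounds {η : Euc 2 → ℝ} {t B : ℝ} {x : Euc 2} (ht : 0 ≤ t) (h0 : 0 ≤ η x) (h1 : η x ≤ 1)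
    (hB0 : 0 ≤ B) (hB : ‖gradient η x‖ * ‖x‖ ≤ B) (htB : t * (1 + B) ≤ 1 / 2) :
    jac η t x ≤ 3 ∧ 1 + 2 * t * η x - t * (‖gradient η x‖ * ‖x‖) - t ^ 2 * B ≤ jac η t x := by
  have i0 := abs_real_inner_le_norm x (gradient η x)
  rw [mul_comm] at i0
  have i1 := abs_le.1 i0
  unfold jac
  set s := ⟪x, gradient η x⟫
  set b := ‖gradient η x‖ * ‖x‖
  have j1 : t * η x ≤ t := by nlinarith
  have j2 : 0 ≤ t * η x := by positivity
  have j3 : t * s ≤ t * B := by gcongr; linarith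
  have j5 : 0 ≤ t * B := by positivity
  constructor
  · nlinarith
  · have j4 : -B ≤ η x * s := by nlinarith
    have j6 := mul_le_mul_of_nonneg_left j4 (sq_nonneg t)
    have j7 : t * -b ≤ t * s := by gcongr; exact i1.1
    nlinarith [sq_nonneg (t * η x)]

section
variable {A E : Set (Euc 2)} {K : Finset (Euc 2)} {u : ℕ → Euc 2 → ℝ} {h : ℝ}

lemma Ctx.supp_push (c : Ctx A E K u h) {r : ℝ} (hr : 0 < r) (hs : PtSep K r) :
    ∃ t0 : ℝ, 0 < t0 ∧ ∀ t : ℝ, 0 ≤ t → t < t0 → ∀ δ : ℝ, 0 < δ → ∀ᶠ k in atTop, ∀ x, u k x ≠ 0 →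
      (∀ q ∈ K, δ ≤ dist x q) → dfm (cut K r) t x ∈ A := by
  obtain ⟨ε, hε, hth⟩ := c.thick (half_pos hr)
  obtain ⟨R, hR⟩ := (c.bddE.cthickening (δ := ε / 2)).exists_norm_le
  have hR1 : 0 < |R| + 1 := by positivity
  refine ⟨min (ε / 2) (r / 2) / (|R| + 1), by positivity, fun t ht htt δ hδ => ?_⟩
  rw [lt_div_iff₀ hR1] at htt
  filter_upwards [c.supp_small (half_pos hε), c.supp_cut hδ] with k h1 h2 x hx hxK
  have hxE : x ∈ cthickening (ε / 2) E := h1 hx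
  have hxR : ‖x‖ ≤ |R| + 1 := by linarith [hR x hxE, le_abs_self R]
  have hcm := cut_mem hr hs x
  have hdist : dist (dfm (cut K r) t x) x < min (ε / 2) (r / 2) := by
    rw [dist_eq_norm]
    have : dfm (cut K r) t x - x = t • (cut K r x • x) := by unfold dfm; abel
    rw [this, norm_smul, norm_smul, Real.norm_of_nonneg ht, Real.norm_of_nonneg hcm.1]
    calc t * (cut K r x * ‖x‖) ≤ t * (1 * (|R| + 1)) := by
          gcongr
          exact hcm.2
      _ < _ := by rw [one_mul]; exact htt
  have hy : dfm (cut K r) t x ∈ cthickening ε E := by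
    have := cthickening_cthickening_subset (half_pos hε).le (half_pos hε).le E
      (mem_cthickening_of_dist_le _ _ (ε / 2) _ hxE (hdist.le.trans (min_le_left _ _)))
    rwa [add_halves] at this
  rcases hth hy with h3 | h3
  · exact h3
  · simp only [mem_iUnion, exists_prop] at h3
    obtain ⟨q, hq, hyq⟩ := h3
    have hxq : dist x q ≤ r := by
      have := dist_triangle x (dfm (cut K r) t x) q
      rw [dist_comm x (dfm (cut K r) t x)] at this
      have h4 := hdist.trans_le (min_le_right _ _)
      rw [mem_ball] at hyq
      linarith
    have h0 : cut K r x = 0 := cut_zero hr hs hq hxq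
    have : dfm (cut K r) t x = x := by unfold dfm; rw [h0]; simp
    rw [this]
    rcases h2 x hx with h5 | ⟨p, hp, h5⟩
    · exact h5
    · exact absurd h5 (not_lt.2 (hxK p hp))

lemma Ctx.step (c : Ctx A E K u h) {r t B t0 ε1 C R : ℝ} (hr : 0 < r) (hs : PtSep K r)
    (hB0 : 0 ≤ B) (hB : ∀ x, ‖gradient (cut K r) x‖ * ‖x‖ ≤ B) (ht : 0 < t) (htB : t * (1 + B) ≤ 1 / 2)
    (htt : t < t0)
    (hsupp : ∀ t : ℝ, 0 ≤ t → t < t0 → ∀ δ : ℝ, 0 < δ → ∀ᶠ k in atTop, ∀ x, u k x ≠ 0 →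
      (∀ q ∈ K, δ ≤ dist x q) → dfm (cut K r) t x ∈ A)
    (hI4 : ∀ᶠ k in atTop, ∃ F : Euc 2 → ℝ, Integrable F ∧
      (∀ x, QQ x (gradient (cut K r) x) (gradient (u k) x) ≤ F x) ∧ ∫ x, F x ≤ ε1)
    (hC1 : ∫ x in E, ‖gradient (cut K r) x‖ ≤ C * r) (hC2 : ∫ x in E, (1 - cut K r x) ≤ C * r ^ 2)
    (hR0 : 0 ≤ R) (hR : ∀ x ∈ E, ‖x‖ ≤ R) {ε : ℝ} (hε : 0 < ε) :
    h * (volume.real E + 2 * t * (volume.real E - C * r ^ 2) - t * (R * (C * r)) -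
        t ^ 2 * B * volume.real E - 3 * ε) ≤
      h * volume.real E * (1 + t + (1 + 2 * B) ^ 2 * t ^ 2) + t * ε1 + 5 * ε := by
  obtain ⟨β, δ, hδ, hβs, hβ0, hβ1, hβz, hβg, hβi⟩ := c.exists_beta hε
  set η := cut K r with hη
  have hη1 : ContDiff ℝ 1 η := (cut_contDiff K r).of_le one_le_top'
  have hβ : ContDiff ℝ 1 β := hβs.of_le one_le_top'
  have e0 : ∀ x, 0 ≤ η x := fun x => (cut_mem hr hs x).1
  have e1 : ∀ x, η x ≤ 1 := fun x => (cut_mem hr hs x).2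
  have hjc : Continuous (jac η t) := by
    unfold jac
    have := hη1.continuous
    have := cont_grad hη1
    fun_prop
  have hlim1 := (c.mol.lim (fun x => β x * jac η t x) (hβ.continuous.mul hjc)).const_mul h
  have hlim2 := c.mol.lim (fun x => ‖gradient β x‖) (cont_grad hβ).norm
  have hEfin : volume E ≠ ⊤ := c.bddE.measure_lt_top.ne
  -- inequality for large k
  have hk : ∀ᶠ k in atTop, h * ∫ x, u k x * (β x * jac η t x) ≤
      h * volume.real E * (1 + t + (1 + 2 * B) ^ 2 * t ^ 2) + t * ε1 + 3 * (2 * ε / 2) := by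
    have l2 : ∫ x in E, ‖gradient β x‖ < ε := hβg
    filter_upwards [hsupp t ht.le htt δ hδ, hI4, hlim2.eventually (gt_mem_nhds l2)] with k k1 k2 k3
    obtain ⟨F, hF1, hF2, hF3⟩ := k2
    have hu1 := c.smooth1 k
    have hf : ContDiff ℝ 1 (fun x => u k x * β x) := hu1.mul hβ
    have hfc : HasCompactSupport (fun x => u k x * β x) := (c.mol.compSupp k).mul_right
    have push := dfm_push c.fun_ineq hη1 ht.le e0 e1 hB0 hB htB hf hfc
      (fun x => mul_nonneg (c.mol.nonneg k x) (hβ0 x)) ?_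
    · have a1 : ∫ x, u k x * (β x * jac η t x) = ∫ x, u k x * β x * jac η t x := by
        congr 1 with x; ring
      rw [a1]
      refine push.trans ?_
      have int1 : Integrable (fun x => ‖gradient (u k) x‖) := by
        simpa using c.int_grad_mul k (ψ := fun _ => 1) continuous_const
      have int2 : Integrable (fun x => u k x * ‖gradient β x‖) := c.int_u_mul k (cont_grad hβ).norm
      have i1 : Integrable (fun x => (1 + t + (1 + 2 * B) ^ 2 * t ^ 2) * ‖gradient (u k) x‖) :=
        int1.const_mul _
      have i2 : Integrable (fun x => t * F x) := hF1.const_mul _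
      have i3 : Integrable (fun x => 3 * (u k x * ‖gradient β x‖)) := int2.const_mul _
      have i12 : Integrable (fun x => (1 + t + (1 + 2 * B) ^ 2 * t ^ 2) * ‖gradient (u k) x‖ + t * F x) :=
        i1.add i2
      calc ∫ x, ‖cof η t x (gradient (fun x => u k x * β x) x)‖
          ≤ ∫ x, ((1 + t + (1 + 2 * B) ^ 2 * t ^ 2) * ‖gradient (u k) x‖ + t * F x +
              3 * (u k x * ‖gradient β x‖)) := by
            refine integral_mono_of_nonneg (ae_of_all _ fun x => norm_nonneg _) (i12.add i3)
              (ae_of_all _ fun x => ?_)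
            have g1 := grad_mul (hu1.differentiable one_ne_zero x) (hβ.differentiable one_ne_zero x)
            have g2 : cof η t x (u k x • gradient β x + β x • gradient (u k) x) =
                u k x • cof η t x (gradient β x) + β x • cof η t x (gradient (u k) x) := by
              unfold cof
              rw [inner_add_right, inner_smul_right, inner_smul_right]
              module
            beta_reduce
            rw [g1, g2]
            have b1 := cof_bound ht.le (e0 x) (e1 x) hB0 (hB x) (gradient (u k) x)
            have b2 := cof_bound3 ht.le (e0 x) (e1 x) hB0 (hB x) htB (gradient β x)
            have b3 := hF2 x
            have u0 := c.mol.nonneg k x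
            refine (norm_add_le _ _).trans ?_
            rw [norm_smul, norm_smul, Real.norm_of_nonneg u0, Real.norm_of_nonneg (hβ0 x)]
            have b4 := mul_le_mul_of_nonneg_left b2 u0
            have b5 : β x * ‖cof η t x (gradient (u k) x)‖ ≤ ‖cof η t x (gradient (u k) x)‖ :=
              mul_le_of_le_one_left (norm_nonneg _) (hβ1 x)
            have b6 := mul_le_mul_of_nonneg_left b3 ht.le
            linarith
        _ = (1 + t + (1 + 2 * B) ^ 2 * t ^ 2) * (∫ x, ‖gradient (u k) x‖) + t * (∫ x, F x) +
              3 * (∫ x, u k x * ‖gradient β x‖) := by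
            rw [integral_add i12 i3, integral_add i1 i2, integral_const_mul, integral_const_mul,
              integral_const_mul]
        _ ≤ (1 + t + (1 + 2 * B) ^ 2 * t ^ 2) * (h * volume.real E) + t * ε1 + 3 * (2 * ε / 2) := by
            gcongr
            · rw [← c.perim]; exact c.mol.grad_le k
            · linarith
        _ = _ := by ring
    · intro x hx
      refine k1 x (left_ne_zero_of_mul hx) fun q hq => ?_
      by_contra hlt
      exact right_ne_zero_of_mul hx (hβz q hq x (not_le.1 hlt).le)
  have hfinal := le_of_tendsto hlim1 hk
  -- lower bound of the integral
  have hgc : Continuous (fun x => ‖gradient η x‖) := (cont_grad hη1).norm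
  have ic : IntegrableOn (fun _ : Euc 2 => (1 : ℝ)) E := integrableOn_const hEfin
  have iη : IntegrableOn (fun x => 1 - η x) E := int_on c.bddE (continuous_const.sub hη1.continuous)
  have ig : IntegrableOn (fun x => ‖gradient η x‖) E := int_on c.bddE hgc
  have iβ : IntegrableOn (fun x => 1 - β x) E := int_on c.bddE (continuous_const.sub hβ.continuous)
  have j1 : IntegrableOn (fun _ : Euc 2 => 1 + 2 * t - t ^ 2 * B) E := integrableOn_const hEfin
  have j2 : IntegrableOn (fun x => 2 * t * (1 - η x)) E := iη.const_mul _
  have j3 : IntegrableOn (fun x => t * R * ‖gradient η x‖) E := ig.const_mul _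
  have j4 : IntegrableOn (fun x => 3 * (1 - β x)) E := iβ.const_mul _
  have j12 : IntegrableOn (fun x => (1 + 2 * t - t ^ 2 * B) - 2 * t * (1 - η x)) E := j1.sub j2
  have j123 : IntegrableOn (fun x => (1 + 2 * t - t ^ 2 * B) - 2 * t * (1 - η x)
    - t * R * ‖gradient η x‖) E := j12.sub j3
  have low : ∫ x in E, ((1 + 2 * t - t ^ 2 * B) - 2 * t * (1 - η x)
      - t * R * ‖gradient η x‖ - 3 * (1 - β x)) ≤ ∫ x in E, β x * jac η t x := by
    refine setIntegral_mono_on (j123.sub j4) (int_on c.bddE (hβ.continuous.mul hjc)) c.measE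
      fun x hx => ?_
    obtain ⟨b1, b2⟩ := jac_bounds ht.le (e0 x) (e1 x) hB0 (hB x) htB
    have b3 : ‖gradient η x‖ * ‖x‖ ≤ ‖gradient η x‖ * R := by gcongr; exact hR x hx
    have b4 := mul_le_mul_of_nonneg_left b3 ht.le
    have b5 := mul_le_mul_of_nonneg_left b1 (sub_nonneg.2 (hβ1 x))
    nlinarith
  rw [integral_sub j123 j4, integral_sub j12 j3, integral_sub j1 j2, integral_const_mul,
    integral_const_mul, integral_const_mul, setIntegral_const, smul_eq_mul] at low
  have m1 := mul_le_mul_of_nonneg_left hC2 (show 0 ≤ 2 * t by positivity)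
  have m2 := mul_le_mul_of_nonneg_left hC1 (show 0 ≤ t * R by positivity)
  refine (mul_le_mul_of_nonneg_left ?_ c.hpos.le).trans (hfinal.trans (by linarith))
  linarith

lemma Ctx.false (c : Ctx A E K u h) : False := by
  have hh := c.hpos
  have hV := c.volpos
  set V := volume.real E
  obtain ⟨C, hC, hCb⟩ := exists_cut_bounds K
  obtain ⟨R0, hR0⟩ := c.bddE.exists_norm_le
  set R := |R0| with hRdef
  have hRn : 0 ≤ R := abs_nonneg _
  have hR : ∀ x ∈ E, ‖x‖ ≤ R := fun x hx => (hR0 x hx).trans (le_abs_self _)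
  have hε1 : 0 < h * V / 4 := by positivity
  have hsm : ∀ᶠ r : ℝ in 𝓝[>] 0, h * (2 * C * r ^ 2 + R * (C * r)) < h * V / 4 := by
    have : Tendsto (fun r : ℝ => h * (2 * C * r ^ 2 + R * (C * r))) (𝓝 0)
        (𝓝 (h * (2 * C * 0 ^ 2 + R * (C * 0)))) := Continuous.tendsto (by fun_prop) 0
    refine (this.mono_left nhdsWithin_le_nhds).eventually (gt_mem_nhds ?_)
    simpa using hε1
  obtain ⟨r, ⟨⟨hs, hI4⟩, hrs⟩, hr⟩ := (((sep_eventually K).and (c.I4 hε1)).and hsm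
    |>.and self_mem_nhdsWithin).exists
  have hr : 0 < r := hr
  obtain ⟨B, hB0, hB⟩ := exists_cut_B K hr
  obtain ⟨t0, ht0, hsupp⟩ := c.supp_push hr hs
  have hD : 0 < h * V * (1 + 2 * B) ^ 2 + 5 + 3 * h + h * B * V := by positivity
  set D := h * V * (1 + 2 * B) ^ 2 + 5 + 3 * h + h * B * V with hDdef
  have hT : 0 < min (min (t0 / 2) (1 / (2 * (1 + B)))) (h * V / (4 * D)) := by positivity
  set t := min (min (t0 / 2) (1 / (2 * (1 + B)))) (h * V / (4 * D)) with htdef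
  have t1 : t < t0 := by
    have : t ≤ t0 / 2 := (min_le_left _ _).trans (min_le_left _ _)
    linarith
  have t2 : t * (1 + B) ≤ 1 / 2 := by
    have : t ≤ 1 / (2 * (1 + B)) := (min_le_left _ _).trans (min_le_right _ _)
    rw [le_div_iff₀ (by positivity)] at this
    linarith
  have t3 : t * D ≤ h * V / 4 := by
    have : t ≤ h * V / (4 * D) := min_le_right _ _
    rw [le_div_iff₀ (by positivity)] at this
    linarith
  obtain ⟨hC1, hC2⟩ := hCb E c.measE c.bddE r hr
  have key := c.step hr hs hB0 hB hT t2 t1 hsupp hI4 hC1 hC2 hRn hR (ε := t ^ 2) (by positivity)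
  have k2 : t * (h * V) ≤ t * (h * (2 * C * r ^ 2 + R * (C * r)) + h * V / 4 + t * D) := by
    rw [hDdef]
    change h * (V + 2 * t * (V - C * r ^ 2) - t * (R * (C * r)) - t ^ 2 * B * V - 3 * t ^ 2) ≤ _ at key
    linarith
  have k3 := le_of_mul_le_mul_left k2 hT
  nlinarith

end

/-- **Lemma `nel piano!`**: let `E` be a Cheeger set of an open bounded set `A ⊂ ℝ²`.
If the set `bd_{∂A}(∂A ∩ ∂E) = (∂A ∩ ∂E) ∩ closure (∂A \ ∂E)` is finite and every point
of `∂A ∩ ∂E` is a regular point of `∂A` (i.e. `∂A ∩ ∂E ⊆ ∂*A`), then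
`ℋ¹(∂E ∩ ∂A) > 0`. -/
theorem cheeger_set_touches_boundary_positively (A E : Set (Euc 2))
    (hAopen : IsOpen A) (hAbd : IsBounded A) (hE : IsCheegerSet E A)
    (hfin : Set.Finite ((frontier A ∩ frontier E) ∩ closure (frontier A \ frontier E)))
    (hreg : frontier A ∩ frontier E ⊆ redBoundary A) :
    0 < μH[(1 : ℝ)] (frontier E ∩ frontier A) := by
  by_contra hneg
  have h0 : μH[(1 : ℝ)] (frontier E ∩ frontier A) = 0 := by simpa using hneg
  obtain ⟨K, u, h, c⟩ := exists_ctx A E hAopen hAbd hE hfin hreg h0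
  exact c.false

end
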